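/- arXiv:2209.15114 — 2 statements merged into one kernel-verified Lean document; each statement's English description precedes it below -/
import Mathlib

section
/- As n → ∞, the empirical root measures μ_{M_n} of the crank principal polynomials M_n(w) converge weakly to ν, the uniform probability measure on the unit circle; that is, the roots of M_n(w) tend to equidistribution on the unit circle. -/
open Finset MeasureTheory Filter

/-- The empirical root measure `μ_f = (1/d) ∑_{j=1}^{d} δ_{z_j}` of a polynomial `f` of
degree `d` with roots `z₁,…,z_d ∈ ℂ` listed with multiplicity. -/
noncomputable def rootMeasure (f : Polynomial ℂ) : Measure ℂ :=
  ((f.natDegree : ENNReal))⁻¹ • (f.roots.map MeasureTheory.Measure.dirac).sum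

/-- The uniform (Haar) probability measure `ν` on the unit circle `{z ∈ ℂ : |z| = 1}`. -/
noncomputable def circleUniform : Measure ℂ :=
  (ENNReal.ofReal (2 * Real.pi))⁻¹ •
    Measure.map (fun θ : ℝ => Complex.exp (θ * Complex.I))
      (volume.restrict (Set.Ioc (0 : ℝ) (2 * Real.pi)))

/-- The crank of a partition `λ`: the largest part if `1` is not a part of `λ`, and
otherwise `μ(λ) − o(λ)`, where `o(λ)` is the number of `1`s in `λ` and `μ(λ)` is the
number of parts of `λ` strictly larger than `o(λ)`. -/
def partitionCrank {n : ℕ} (π : Nat.Partition n) : ℤ :=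
  if (1 : ℕ) ∉ π.parts then (π.parts.sup : ℤ)
  else (Multiset.card (π.parts.filter (fun a => π.parts.count 1 < a)) : ℤ) -
    π.parts.count 1

/-- `M(m,n)`: the number of partitions of `n` with crank `m`. -/
noncomputable def crankCount (m : ℤ) (n : ℕ) : ℕ :=
  Nat.card {π : Nat.Partition n // partitionCrank π = m}

/-- The crank principal polynomial `M_n(w) = M(0,n)/2 + ∑_{1 ≤ m ≤ n} M(m,n) wᵐ`. -/
noncomputable def crankPrincipal (n : ℕ) : Polynomial ℂ :=
  Polynomial.C ((crankCount 0 n : ℂ) / 2) +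
    ∑ m ∈ Finset.Icc 1 n, Polynomial.C ((crankCount m n : ℕ) : ℂ) * Polynomial.X ^ m

theorem partition_card_mul_pow_le {r : ℝ} (hr0 : 0 < r) (hr1 : r < 1) (n : ℕ) :
    (Fintype.card (Nat.Partition n) : ℝ) * r ^ n ≤ Real.exp ((1 - r)⁻¹ * (1 - r)⁻¹) := by
  classical
  have hbound : ∀ (π : Nat.Partition n) (k : ℕ), n < k → π.parts.count k = 0 := by
    intro π k hk
    refine Multiset.count_eq_zero_of_notMem fun h => ?_
    have := π.le_of_mem_parts h
    omega
  have hzero : ∀ π : Nat.Partition n, π.parts.count 0 = 0 := by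
    intro π
    exact Multiset.count_eq_zero_of_notMem fun h => (π.parts_pos h).ne rfl
  have hsum : ∀ π : Nat.Partition n,
      ∑ i : Fin n, ((i : ℕ) + 1) * π.parts.count ((i : ℕ) + 1) = n := by
    intro π
    have h1 : π.parts.sum = ∑ m ∈ range (n + 1), π.parts.count m • m := by
      refine Finset.sum_multiset_count_of_subset _ _ fun a ha => ?_
      have := π.le_of_mem_parts (Multiset.mem_toFinset.1 ha)
      simp; omega
    rw [π.parts_sum, sum_range_succ', Finset.sum_range] at h1
    simp only [smul_eq_mul, mul_zero, add_zero] at h1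
    conv_rhs => rw [h1]
    exact sum_congr rfl fun i _ => mul_comm _ _
  let F : Nat.Partition n → (Fin n → ℕ) := fun π i => π.parts.count ((i : ℕ) + 1)
  have hF : Function.Injective F := by
    intro π ρ h
    apply Nat.Partition.ext
    ext k
    rcases Nat.eq_zero_or_pos k with rfl | hk
    · rw [hzero, hzero]
    · by_cases hkn : k ≤ n
      · have := congrFun h ⟨k - 1, by omega⟩
        simpa [F, Nat.sub_add_cancel hk] using this
      · rw [hbound _ _ (by omega), hbound _ _ (by omega)]
  have hpos : 0 < 1 - r := by linarith
  calc (Fintype.card (Nat.Partition n) : ℝ) * r ^ n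
      = ∑ π : Nat.Partition n, ∏ i : Fin n, (r ^ ((i : ℕ) + 1)) ^ (F π i) := by
        rw [← Finset.card_univ, ← nsmul_eq_mul, ← Finset.sum_const]
        refine sum_congr rfl fun π _ => ?_
        simp_rw [← pow_mul]
        rw [Finset.prod_pow_eq_pow_sum, hsum]
    _ = ∑ x ∈ univ.image F, ∏ i : Fin n, (r ^ ((i : ℕ) + 1)) ^ (x i) := by
        rw [sum_image hF.injOn]
    _ ≤ ∑ x ∈ Fintype.piFinset (fun _ : Fin n => range (n + 1)),
          ∏ i : Fin n, (r ^ ((i : ℕ) + 1)) ^ (x i) := by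
        refine sum_le_sum_of_subset_of_nonneg ?_ fun _ _ _ => by positivity
        intro x hx
        obtain ⟨π, -, rfl⟩ := mem_image.1 hx
        refine Fintype.mem_piFinset.2 fun i => mem_range.2 ?_
        have := single_le_sum (f := fun i : Fin n => ((i : ℕ) + 1) * π.parts.count ((i : ℕ) + 1))
          (fun _ _ => Nat.zero_le _) (mem_univ i)
        simp only [hsum] at this
        simp only [F]
        nlinarith
    _ = ∏ i : Fin n, ∑ j ∈ range (n + 1), (r ^ ((i : ℕ) + 1)) ^ j := (prod_univ_sum _ _).symm
    _ ≤ ∏ i : Fin n, Real.exp ((1 - r)⁻¹ * r ^ (i : ℕ)) := by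
        refine prod_le_prod (fun _ _ => by positivity) fun i _ => ?_
        have hq0 : 0 < r ^ ((i : ℕ) + 1) := by positivity
        have hqr : r ^ ((i : ℕ) + 1) ≤ r := pow_le_of_le_one hr0.le hr1.le (by omega)
        set q := r ^ ((i : ℕ) + 1)
        have h1 : ∑ j ∈ range (n + 1), q ^ j ≤ (1 - q)⁻¹ :=
          (summable_geometric_of_lt_one hq0.le (hqr.trans_lt hr1)).sum_le_tsum _
            (fun _ _ => by positivity) |>.trans_eq (tsum_geometric_of_lt_one hq0.le (hqr.trans_lt hr1))
        have h2 : (1 - q)⁻¹ ≤ 1 + (1 - r)⁻¹ * q := by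
          have hq1 : 0 < 1 - q := by linarith
          have : (1 - q)⁻¹ = 1 + (1 - q)⁻¹ * q := by field_simp; ring
          rw [this]
          gcongr
        have h3 : (1 - r)⁻¹ * q ≤ (1 - r)⁻¹ * r ^ (i : ℕ) := by
          gcongr
          exact pow_le_pow_of_le_one hr0.le hr1.le (by omega)
        linarith [Real.add_one_le_exp ((1 - r)⁻¹ * r ^ (i : ℕ))]
    _ = Real.exp ((1 - r)⁻¹ * ∑ i ∈ range n, r ^ i) := by
        rw [← Real.exp_sum, ← mul_sum, Finset.sum_range]
    _ ≤ Real.exp ((1 - r)⁻¹ * (1 - r)⁻¹) := by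
        gcongr
        exact (summable_geometric_of_lt_one hr0.le hr1).sum_le_tsum _
            (fun _ _ => by positivity) |>.trans_eq (tsum_geometric_of_lt_one hr0.le hr1)

theorem tendsto_log_card_partition_div :
    Tendsto (fun n : ℕ => Real.log (2 * Fintype.card (Nat.Partition n)) / n) atTop (nhds 0) := by
  have hone : ∀ n : ℕ, (1 : ℝ) ≤ Fintype.card (Nat.Partition n) := fun n => by
    exact_mod_cast Fintype.card_pos
  rw [Metric.tendsto_atTop]
  intro ε hε
  set r := Real.exp (-(ε / 2)) with hr
  have hr1 : r < 1 := by rw [hr, Real.exp_lt_one_iff]; linarith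
  set C := Real.log 2 + (1 - r)⁻¹ * (1 - r)⁻¹
  obtain ⟨N, hN⟩ := exists_nat_gt (C / (ε / 2))
  refine ⟨N + 1, fun n hn => ?_⟩
  have hn0 : (0 : ℝ) < n := by exact_mod_cast (by omega : 0 < n)
  have hNn : (N : ℝ) < n := by exact_mod_cast hn
  have h := partition_card_mul_pow_le (Real.exp_pos _) hr1 n
  have h1 := Real.log_le_log (mul_pos (by linarith [hone n]) (by positivity)) h
  rw [Real.log_exp, Real.log_mul (by linarith [hone n]) (by positivity), Real.log_pow,
    Real.log_exp] at h1
  have h0 : 0 ≤ Real.log (2 * Fintype.card (Nat.Partition n)) :=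
    Real.log_nonneg (by linarith [hone n])
  rw [Real.dist_eq, sub_zero, abs_of_nonneg (by positivity), div_lt_iff₀ hn0,
    Real.log_mul (by norm_num) (by linarith [hone n])]
  rw [div_lt_iff₀ (by positivity)] at hN
  have h2 : (N : ℝ) * (ε / 2) < n * (ε / 2) := by gcongr
  simp only [C, hr] at hN
  linarith

theorem norm_sum_pow_le_of_prod_norm_sub_le {ι : Type*} [Fintype ι] {u : ι → ℂ}
    (hu : ∀ i, ‖u i‖ = 1) {A : ℝ} (hA : 0 < A)
    (h : ∀ z : ℂ, ‖z‖ = 1 → ∏ i, ‖z - u i‖ ≤ Real.exp A) {k : ℕ} (hk : k ≠ 0) :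
    ‖∑ i, u i ^ k‖ ≤ 4 * (k * A) := by
  set v : ι → ℂ := fun i => (starRingEnd ℂ) (u i) with hv
  have hv1 : ∀ i, ‖v i‖ = 1 := fun i => by simp [hv, hu]
  have huv : ∀ i, u i * v i = 1 := fun i => by
    rw [hv, Complex.mul_conj, Complex.normSq_eq_norm_sq, hu]; simp
  have hdisc : ∀ z : ℂ, ‖z‖ ≤ 1 → ∏ i, ‖1 - z * v i‖ ≤ Real.exp A := by
    intro z hz
    have key : ‖∏ i, (1 - z * v i)‖ ≤ Real.exp A := by
      refine Complex.norm_le_of_forall_mem_frontier_norm_le (U := Metric.ball (0 : ℂ) 1)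
        (f := fun z => ∏ i, (1 - z * v i)) Metric.isBounded_ball ?_ ?_ ?_
      · exact Differentiable.diffContOnCl (by fun_prop)
      · intro w hw
        rw [frontier_ball _ one_ne_zero, mem_sphere_zero_iff_norm] at hw
        rw [norm_prod]
        refine le_of_eq_of_le (prod_congr rfl fun i _ => ?_) (h w hw)
        have : w - u i = -(u i) * (1 - w * v i) := by linear_combination (-w) * huv i
        rw [this, norm_mul, norm_neg, hu, one_mul]
      · rw [closure_ball _ one_ne_zero]; simpa using hz
    rwa [norm_prod] at key
  have hpow : ∀ z : ℂ, ‖z‖ ≤ 1 → ∏ i, ‖1 - z * v i ^ k‖ ≤ Real.exp (k * A) := by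
    intro z hz
    obtain ⟨w, rfl⟩ := IsAlgClosed.exists_pow_nat_eq z (Nat.pos_of_ne_zero hk)
    have hw : ‖w‖ ≤ 1 := by
      rw [norm_pow] at hz
      exact (pow_le_one_iff_of_nonneg (norm_nonneg _) hk).1 hz
    have hprim := Complex.isPrimitiveRoot_exp k hk
    have hfac : ∀ i, 1 - w ^ k * v i ^ k =
        ∏ ζ ∈ Polynomial.nthRootsFinset k (1 : ℂ), (1 - ζ * w * v i) := by
      intro i
      have := hprim.pow_sub_pow_eq_prod_sub_mul (x := 1) (y := w * v i) (Nat.pos_of_ne_zero hk)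
      rw [one_pow, mul_pow] at this
      rw [this]
      exact prod_congr rfl fun ζ _ => by ring
    simp_rw [hfac, norm_prod]
    rw [Finset.prod_comm]
    calc _ ≤ ∏ ζ ∈ Polynomial.nthRootsFinset k (1 : ℂ), Real.exp A := by
          refine prod_le_prod (fun _ _ => by positivity) fun ζ hζ => hdisc _ ?_
          rw [Polynomial.mem_nthRootsFinset (Nat.pos_of_ne_zero hk)] at hζ
          rw [norm_mul, Complex.norm_eq_one_of_pow_eq_one hζ hk, one_mul]
          exact hw
      _ = _ := by rw [prod_const, hprim.card_nthRootsFinset, ← Real.exp_nat_mul]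
  set g : ℂ → ℂ := fun z => ∑ i, Complex.log (1 - z * v i ^ k) with hg
  have hslit : ∀ z ∈ Metric.ball (0 : ℂ) 1, ∀ i, 1 - z * v i ^ k ∈ Complex.slitPlane := by
    intro z hz i
    rw [sub_eq_add_neg]
    apply Complex.mem_slitPlane_of_norm_lt_one
    simpa [hv1] using hz
  have hgd : ∀ z ∈ Metric.ball (0 : ℂ) 1,
      HasDerivAt g (∑ i, (-(v i ^ k)) / (1 - z * v i ^ k)) z := by
    intro z hz
    refine HasDerivAt.fun_sum fun i _ => ?_
    refine HasDerivAt.clog ?_ (hslit z hz i)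
    simpa using ((hasDerivAt_id z).mul_const (v i ^ k)).const_sub 1
  have hgdiff : DifferentiableOn ℂ g (Metric.ball 0 1) := fun z hz =>
    (hgd z hz).differentiableAt.differentiableWithinAt
  have hre : Set.MapsTo g (Metric.ball 0 1) {z | z.re ≤ k * A} := by
    intro z hz
    have hz1 : ‖z‖ ≤ 1 := (mem_ball_zero_iff.1 hz).le
    change (g z).re ≤ k * A
    simp only [hg, Complex.re_sum, Complex.log_re]
    rw [← Real.log_prod fun i _ => norm_ne_zero_iff.2 (Complex.slitPlane_ne_zero (hslit z hz i))]
    refine (Real.log_le_iff_le_exp (prod_pos fun i _ =>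
      norm_pos_iff.2 (Complex.slitPlane_ne_zero (hslit z hz i)))).2 (hpow z hz1)
  have hkA : 0 < k * A := by positivity
  have hbc : ∀ z ∈ Metric.sphere (0 : ℂ) (1 / 2), ‖g z‖ ≤ 2 * (k * A) := by
    intro z hz
    have hz2 : ‖z‖ = 1 / 2 := by simpa using hz
    have := Complex.borelCaratheodory_zero hkA hgdiff hre one_pos (z := z)
      (by rw [mem_ball_zero_iff, hz2]; norm_num) (by simp [hg])
    rw [hz2] at this
    exact this.trans_eq (by ring)
  have hder := Complex.norm_deriv_le_of_forall_mem_sphere_norm_le (by norm_num : (0 : ℝ) < 1 / 2)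
    (hgdiff.diffContOnCl_ball (Metric.closedBall_subset_ball (by norm_num))) hbc
  rw [(hgd 0 (by simp)).deriv] at hder
  have : ‖∑ i, u i ^ k‖ = ‖∑ i, (-(v i ^ k)) / (1 - 0 * v i ^ k)‖ := by
    simp only [zero_mul, sub_zero, div_one, sum_neg_distrib, norm_neg, hv]
    rw [← Complex.norm_conj]
    simp
  rw [this]
  linarith

theorem norm_eval_eq_prod_norm_sub_roots {p : Polynomial ℂ} (hlead : p.leadingCoeff = 1) (w : ℂ) :
    ‖p.eval w‖ = ∏ i : p.roots, ‖w - (i : ℂ)‖ := by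
  rw [(IsAlgClosed.splits p).eval_eq_prod_roots, hlead, one_mul, Finset.prod,
    Multiset.map_univ p.roots (fun z => ‖w - z‖)]
  refine (map_multiset_prod (normHom (α := ℂ)) (p.roots.map (fun a => w - a))).trans ?_
  rw [Multiset.map_map]
  rfl

theorem norm_coeff_zero_eq_prod_norm_roots {p : Polynomial ℂ} (hlead : p.leadingCoeff = 1) :
    ‖p.coeff 0‖ = ∏ i : p.roots, ‖(i : ℂ)‖ := by
  rw [Polynomial.coeff_zero_eq_eval_zero, norm_eval_eq_prod_norm_sub_roots hlead]
  simp

theorem coe_roots_ne_zero {p : Polynomial ℂ} (h0 : p.coeff 0 ≠ 0) (i : p.roots) :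
    (i : ℂ) ≠ 0 := by
  intro hi
  have := Polynomial.isRoot_of_mem_roots (Multiset.coe_mem (x := i))
  rw [hi, Polynomial.IsRoot, ← Polynomial.coeff_zero_eq_eval_zero] at this
  exact h0 this

theorem sum_abs_log_norm_roots_le {p : Polynomial ℂ} {S : ℝ} (hlead : p.leadingCoeff = 1)
    (h0 : 1 / 2 ≤ ‖p.coeff 0‖) (hS : p.sum (fun _ a => ‖a‖) ≤ S) (hS1 : 1 ≤ S) :
    ∑ i : p.roots, |Real.log ‖(i : ℂ)‖| ≤ 2 * Real.log (2 * S) := by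
  have hne : ∀ i : p.roots, (i : ℂ) ≠ 0 :=
    coe_roots_ne_zero (norm_pos_iff.1 (by linarith))
  have hprod := norm_coeff_zero_eq_prod_norm_roots hlead
  have hmahler : ∏ i : p.roots, max 1 ‖(i : ℂ)‖ ≤ S := by
    rw [Finset.prod, Multiset.map_univ p.roots (fun z => max 1 ‖z‖)]
    have := p.mahlerMeasure_eq_leadingCoeff_mul_prod_roots
    rw [hlead, norm_one, one_mul] at this
    rw [← this]
    exact p.mahlerMeasure_le_sum_norm_coeff.trans hS
  have h1 : ∑ i : p.roots, Real.log (max 1 ‖(i : ℂ)‖) ≤ Real.log S := by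
    rw [← Real.log_prod fun i _ => by positivity]
    exact Real.log_le_log (prod_pos fun i _ => by positivity) hmahler
  have h2 : -Real.log 2 ≤ ∑ i : p.roots, Real.log ‖(i : ℂ)‖ := by
    rw [← Real.log_prod fun i _ => norm_ne_zero_iff.2 (hne i), ← hprod, ← Real.log_inv]
    exact Real.log_le_log (by norm_num) (by linarith)
  have h3 : ∀ i : p.roots, |Real.log ‖(i : ℂ)‖| =
      2 * Real.log (max 1 ‖(i : ℂ)‖) - Real.log ‖(i : ℂ)‖ := by
    intro i
    have hpos : 0 < ‖(i : ℂ)‖ := norm_pos_iff.2 (hne i)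
    rcases le_total 1 ‖(i : ℂ)‖ with h | h
    · rw [max_eq_right h, abs_of_nonneg (Real.log_nonneg h)]; ring
    · rw [max_eq_left h, abs_of_nonpos (Real.log_nonpos hpos.le h), Real.log_one]; ring
  simp_rw [h3]
  rw [sum_sub_distrib, ← mul_sum, Real.log_mul (by norm_num) (by linarith)]
  have : 0 < Real.log 2 := Real.log_pos (by norm_num)
  linarith

theorem prod_norm_sub_normalized_roots_le {p : Polynomial ℂ} {S : ℝ} (hlead : p.leadingCoeff = 1)
    (h0 : 1 / 2 ≤ ‖p.coeff 0‖) (hS : p.sum (fun _ a => ‖a‖) ≤ S) (hS1 : 1 ≤ S) {z : ℂ}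
    (hz : ‖z‖ = 1) :
    ∏ i : p.roots, ‖z - (i : ℂ) / ‖(i : ℂ)‖‖ ≤ 2 * S := by
  have hne : ∀ i : p.roots, (i : ℂ) ≠ 0 :=
    coe_roots_ne_zero (norm_pos_iff.1 (by linarith))
  have heval := norm_eval_eq_prod_norm_sub_roots hlead
  have hprod := norm_coeff_zero_eq_prod_norm_roots hlead
  have hpz : ‖p.eval z‖ ≤ S := by
    refine le_trans ?_ hS
    rw [Polynomial.eval_eq_sum]
    refine (norm_sum_le _ _).trans_eq (sum_congr rfl fun i _ => ?_)
    simp [hz]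
  have hpt : ∀ i : p.roots, ‖z - (i : ℂ) / ‖(i : ℂ)‖‖ ^ 2 * ‖(i : ℂ)‖ ≤ ‖z - (i : ℂ)‖ ^ 2 := by
    intro i
    set ρ := ‖(i : ℂ)‖ with hρ
    have hρ0 : 0 < ρ := norm_pos_iff.2 (hne i)
    set u := (i : ℂ) / ρ with hu
    have hi : (i : ℂ) = ρ * u := by
      rw [hu, mul_div_cancel₀ _ (Complex.ofReal_ne_zero.2 hρ0.ne')]
    have hu1 : ‖u‖ = 1 := by
      rw [hu, norm_div, Complex.norm_real, Real.norm_of_nonneg hρ0.le, ← hρ, div_self hρ0.ne']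
    rw [hi]
    rw [← sq_eq_sq₀ (norm_nonneg _) zero_le_one, Complex.sq_norm, Complex.normSq_apply] at hz hu1
    simp only [Complex.sq_norm, Complex.normSq_apply, Complex.sub_re, Complex.sub_im,
      Complex.mul_re, Complex.mul_im, Complex.ofReal_re, Complex.ofReal_im, zero_mul, sub_zero,
      add_zero]
    nlinarith [sq_nonneg (ρ - 1)]
  have hsq : (∏ i : p.roots, ‖z - (i : ℂ) / ‖(i : ℂ)‖‖) ^ 2 * ‖p.coeff 0‖ ≤ ‖p.eval z‖ ^ 2 := by
    rw [hprod, heval, ← prod_pow, ← prod_pow, ← prod_mul_distrib]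
    exact prod_le_prod (fun _ _ => by positivity) fun i _ => hpt i
  have hP : 0 ≤ ∏ i : p.roots, ‖z - (i : ℂ) / ‖(i : ℂ)‖‖ := prod_nonneg fun _ _ => norm_nonneg _
  refine le_of_sq_le_sq ?_ (by linarith)
  nlinarith [norm_nonneg (p.eval z), mul_le_mul_of_nonneg_left h0
    (sq_nonneg (∏ i : p.roots, ‖z - (i : ℂ) / ‖(i : ℂ)‖‖))]

theorem tendsto_average_arg {α : Type*} {l : Filter α} {ι : α → Type*} [∀ n, Fintype (ι n)]
    [Fact (0 < 2 * Real.pi)]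
    {z : ∀ n, ι n → ℂ} (hcard : ∀ᶠ n in l, 0 < Fintype.card (ι n))
    (hz : ∀ᶠ n in l, ∀ i, z n i ≠ 0)
    (hpow : ∀ k : ℕ, k ≠ 0 → Tendsto
      (fun n => (Fintype.card (ι n) : ℂ)⁻¹ * ∑ i, (z n i / ‖z n i‖) ^ k) l (nhds 0))
    (h : C(AddCircle (2 * Real.pi), ℂ)) :
    Tendsto (fun n => (Fintype.card (ι n) : ℂ)⁻¹ *
      ∑ i, h ((z n i).arg : AddCircle (2 * Real.pi))) l
      (nhds (∫ θ, h θ ∂AddCircle.haarAddCircle)) := by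
  have h_integral : ∀ f : C(AddCircle (2 * Real.pi), ℂ), Integrable f AddCircle.haarAddCircle :=
    fun f => f.continuous.integrable_of_hasCompactSupport (HasCompactSupport.of_compactSpace f)
  let V : Submodule ℂ C(AddCircle (2 * Real.pi), ℂ) :=
    { carrier := {f | Tendsto (fun n => (Fintype.card (ι n) : ℂ)⁻¹ *
        ∑ i, f ((z n i).arg : AddCircle (2 * Real.pi))) l
        (nhds (∫ θ, f θ ∂AddCircle.haarAddCircle))}
      add_mem' := by
        intro f g hf hg
        have := Tendsto.add hf hg
        simp only [Set.mem_ofPred_eq, ContinuousMap.add_apply, sum_add_distrib, mul_add]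
        rwa [integral_add (h_integral f) (h_integral g)]
      zero_mem' := by simp [tendsto_const_nhds]
      smul_mem' := by
        intro c f hf
        have := Tendsto.const_mul c hf
        simp only [Set.mem_ofPred_eq, ContinuousMap.smul_apply, smul_eq_mul, ← mul_sum,
          integral_const_mul]
        simpa only [mul_left_comm] using this }
  have hpoint : ∀ n, (∀ i, z n i ≠ 0) → ∀ (k : ℕ) i,
      fourier (k : ℤ) ((z n i).arg : AddCircle (2 * Real.pi)) = (z n i / ‖z n i‖) ^ k := by
    intro n hn k i
    have h1 : z n i / ‖z n i‖ = Complex.exp ((z n i).arg * Complex.I) := by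
      rw [div_eq_iff (by simpa using hn i), mul_comm]
      exact (Complex.norm_mul_exp_arg_mul_I _).symm
    rw [fourier_coe_apply, h1, ← Complex.exp_nat_mul]
    congr 1
    push_cast
    have : (Real.pi : ℂ) ≠ 0 := by exact_mod_cast Real.pi_ne_zero
    field_simp
  have hfint : ∀ k : ℤ, k ≠ 0 →
      ∫ θ : AddCircle (2 * Real.pi), fourier k θ ∂AddCircle.haarAddCircle = 0 := by
    intro k hk
    have := congrFun (fourierCoeff_fourier (T := 2 * Real.pi) k) 0
    rw [Pi.single_eq_of_ne hk.symm] at this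
    simpa [fourierCoeff] using this
  have hnat : ∀ k : ℕ, k ≠ 0 → (fourier (k : ℤ) : C(AddCircle (2 * Real.pi), ℂ)) ∈ V := by
    intro k hk
    change Tendsto _ _ _
    rw [hfint k (by exact_mod_cast hk)]
    refine (hpow k hk).congr' ?_
    filter_upwards [hz] with n hn
    simp_rw [hpoint n hn]
  have hspan : ∀ k : ℤ, (fourier k : C(AddCircle (2 * Real.pi), ℂ)) ∈ V := by
    intro k
    rcases lt_trichotomy k 0 with hk | rfl | hk
    · obtain ⟨m, rfl⟩ : ∃ m : ℕ, k = -(m : ℤ) := ⟨k.natAbs, by omega⟩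
      have hm : m ≠ 0 := by omega
      change Tendsto _ _ _
      rw [hfint _ hk.ne]
      have := (Complex.continuous_conj.tendsto _).comp (hnat m hm)
      rw [hfint m (by exact_mod_cast hm), map_zero] at this
      refine this.congr fun n => ?_
      simp only [Function.comp, map_mul, map_sum, map_inv₀, Complex.conj_natCast, fourier_neg]
    · change Tendsto _ _ _
      simp only [fourier_zero, integral_const, probReal_univ, one_smul]
      refine tendsto_const_nhds.congr' ?_
      filter_upwards [hcard] with n hn
      rw [sum_const, card_univ, nsmul_eq_mul, mul_one, inv_mul_cancel₀]
      exact_mod_cast hn.ne'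
    · obtain ⟨m, rfl⟩ : ∃ m : ℕ, k = (m : ℤ) := ⟨k.natAbs, by omega⟩
      exact hnat m (by omega)
  have hmem : h ∈ (Submodule.span ℂ (Set.range (@fourier (2 * Real.pi)))).topologicalClosure := by
    rw [span_fourier_closure_eq_top]; trivial
  have hle : Submodule.span ℂ (Set.range (@fourier (2 * Real.pi))) ≤ V :=
    Submodule.span_le.2 (by rintro _ ⟨k, rfl⟩; exact hspan k)
  rw [← SetLike.mem_coe, Submodule.topologicalClosure_coe, Metric.mem_closure_iff] at hmem
  rw [Metric.tendsto_nhds]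
  intro ε hε
  obtain ⟨f, hf, hfd⟩ := hmem (ε / 3) (by positivity)
  have hfV : Tendsto _ _ _ := hle hf
  have hpt : ∀ θ, ‖h θ - f θ‖ ≤ ε / 3 := fun θ => by
    rw [← dist_eq_norm]
    exact (ContinuousMap.dist_apply_le_dist θ).trans hfd.le
  have hI : dist (∫ θ, f θ ∂AddCircle.haarAddCircle) (∫ θ, h θ ∂AddCircle.haarAddCircle) ≤
      ε / 3 := by
    rw [dist_comm, dist_eq_norm, ← integral_sub (h_integral h) (h_integral f)]
    simpa using norm_integral_le_of_norm_le_const (μ := AddCircle.haarAddCircle)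
      (Eventually.of_forall hpt)
  filter_upwards [Metric.tendsto_nhds.1 hfV (ε / 3) (by positivity), hcard] with n hn hc
  have hc' : (0 : ℝ) < Fintype.card (ι n) := by exact_mod_cast hc
  have hD : dist ((Fintype.card (ι n) : ℂ)⁻¹ * ∑ i, h ((z n i).arg : AddCircle (2 * Real.pi)))
      ((Fintype.card (ι n) : ℂ)⁻¹ * ∑ i, f ((z n i).arg : AddCircle (2 * Real.pi))) ≤ ε / 3 := by
    rw [dist_eq_norm, ← mul_sub, ← sum_sub_distrib, norm_mul, norm_inv, Complex.norm_natCast,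
      inv_mul_le_iff₀ hc']
    refine (norm_sum_le_of_le _ fun i _ => hpt _).trans_eq ?_
    simp
  have := dist_triangle4 ((Fintype.card (ι n) : ℂ)⁻¹ *
      ∑ i, h ((z n i).arg : AddCircle (2 * Real.pi)))
    ((Fintype.card (ι n) : ℂ)⁻¹ * ∑ i, f ((z n i).arg : AddCircle (2 * Real.pi)))
    (∫ θ, f θ ∂AddCircle.haarAddCircle) (∫ θ, h θ ∂AddCircle.haarAddCircle)
  linarith

theorem exists_abs_sub_normalize_lt (g : BoundedContinuousFunction ℂ ℝ) {ε : ℝ} (hε : 0 < ε) :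
    ∃ δ > 0, ∀ z : ℂ, z ≠ 0 → |Real.log ‖z‖| < δ → |g z - g (z / ‖z‖)| < ε := by
  have hK : IsCompact (Metric.sphere (0 : ℂ) 1) := isCompact_sphere 0 1
  have hU := hK.uniformContinuousAt_of_continuousAt g
    (fun a _ => g.continuous.continuousAt) (Metric.dist_mem_uniformity hε)
  obtain ⟨η, hη, hηU⟩ := Metric.mem_uniformity_dist.1 hU
  obtain ⟨δ, hδ, hexp⟩ := Metric.continuousAt_iff.1 (Real.continuous_exp.continuousAt (x := 0)) η hη
  refine ⟨δ, hδ, fun z hz hlog => ?_⟩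
  have hpos : 0 < ‖z‖ := norm_pos_iff.2 hz
  have hu : ‖z / ‖z‖‖ = 1 := by
    rw [norm_div, Complex.norm_real, norm_norm, div_self hpos.ne']
  have h1 := hexp (x := Real.log ‖z‖) (by simpa [Real.dist_eq] using hlog)
  rw [Real.exp_log hpos, Real.exp_zero, Real.dist_eq] at h1
  have h2 : dist (z / ‖z‖) z < η := by
    have : z - z / ‖z‖ = ((‖z‖ - 1 : ℝ) : ℂ) * (z / ‖z‖) := by
      have : (‖z‖ : ℂ) ≠ 0 := by exact_mod_cast hpos.ne'
      push_cast
      field_simp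
    rw [dist_comm, dist_eq_norm, this, norm_mul, hu, mul_one, Complex.norm_real]
    exact h1
  have h3 : dist (g (z / ‖z‖)) (g z) < ε := hηU h2 (by simpa using hu)
  rwa [dist_comm, Real.dist_eq] at h3

theorem tendsto_average_sub_normalize {α : Type*} {l : Filter α} {ι : α → Type*}
    [∀ n, Fintype (ι n)] {z : ∀ n, ι n → ℂ} (hcard : ∀ᶠ n in l, 0 < Fintype.card (ι n))
    (hz : ∀ᶠ n in l, ∀ i, z n i ≠ 0)
    (hlog : Tendsto (fun n => (Fintype.card (ι n) : ℝ)⁻¹ * ∑ i, |Real.log ‖z n i‖|) l (nhds 0))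
    (g : BoundedContinuousFunction ℂ ℝ) :
    Tendsto (fun n => (Fintype.card (ι n) : ℝ)⁻¹ * ∑ i, (g (z n i) - g (z n i / ‖z n i‖))) l
      (nhds 0) := by
  rw [Metric.tendsto_nhds]
  intro ε hε
  obtain ⟨δ, hδ, hg⟩ := exists_abs_sub_normalize_lt g (half_pos hε)
  set B : ℝ := 2 * ‖g‖ / δ with hB
  have hB0 : 0 ≤ B := by positivity
  have hpt : ∀ w : ℂ, w ≠ 0 → ‖g w - g (w / ‖w‖)‖ ≤ ε / 2 + B * |Real.log ‖w‖| := by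
    intro w hw
    rcases lt_or_ge |Real.log ‖w‖| δ with h | h
    · have := (hg w hw h).le
      have : 0 ≤ B * |Real.log ‖w‖| := by positivity
      rw [Real.norm_eq_abs]
      linarith
    · have h1 : ‖g w - g (w / ‖w‖)‖ ≤ 2 * ‖g‖ := by
        rw [← dist_eq_norm]; exact g.dist_le_two_norm _ _
      have h2 : 2 * ‖g‖ = B * δ := by rw [hB]; field_simp
      have h3 : B * δ ≤ B * |Real.log ‖w‖| := by gcongr
      linarith
  have hlim := hlog.const_mul B
  rw [mul_zero] at hlim
  filter_upwards [hcard, hz, hlim.eventually_lt_const (half_pos hε)] with n hc hn hsmall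
  have hc' : (0 : ℝ) < Fintype.card (ι n) := by exact_mod_cast hc
  rw [dist_zero_right, norm_mul, norm_inv, Real.norm_natCast]
  calc _ ≤ (Fintype.card (ι n) : ℝ)⁻¹ * ∑ i, (ε / 2 + B * |Real.log ‖z n i‖|) := by
        gcongr
        exact norm_sum_le_of_le _ fun i _ => hpt _ (hn i)
    _ = ε / 2 + B * ((Fintype.card (ι n) : ℝ)⁻¹ * ∑ i, |Real.log ‖z n i‖|) := by
        rw [sum_add_distrib, ← mul_sum, sum_const, card_univ, nsmul_eq_mul]
        field_simp
    _ < ε := by linarith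

theorem tendsto_average_of_tendsto_power_sums {α : Type*} {l : Filter α} {ι : α → Type*}
    [∀ n, Fintype (ι n)] {z : ∀ n, ι n → ℂ} (hcard : ∀ᶠ n in l, 0 < Fintype.card (ι n))
    (hz : ∀ᶠ n in l, ∀ i, z n i ≠ 0)
    (hlog : Tendsto (fun n => (Fintype.card (ι n) : ℝ)⁻¹ * ∑ i, |Real.log ‖z n i‖|) l (nhds 0))
    (hpow : ∀ k : ℕ, k ≠ 0 → Tendsto
      (fun n => (Fintype.card (ι n) : ℂ)⁻¹ * ∑ i, (z n i / ‖z n i‖) ^ k) l (nhds 0))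
    (g : BoundedContinuousFunction ℂ ℝ) :
    Tendsto (fun n => (Fintype.card (ι n) : ℝ)⁻¹ * ∑ i, g (z n i)) l
      (nhds (∫ w, g w ∂circleUniform)) := by
  have : Fact (0 < 2 * Real.pi) := ⟨Real.two_pi_pos⟩
  let h : C(AddCircle (2 * Real.pi), ℂ) :=
    ⟨fun θ => ((g (AddCircle.toCircle θ : ℂ) : ℝ) : ℂ), by
      have := AddCircle.continuous_toCircle (T := 2 * Real.pi)
      fun_prop⟩
  have hcoe : ∀ θ : ℝ, h (θ : AddCircle (2 * Real.pi)) =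
      ((g (Complex.exp (θ * Complex.I)) : ℝ) : ℂ) := by
    intro θ
    change ((g (AddCircle.toCircle (θ : AddCircle (2 * Real.pi)) : ℂ) : ℝ) : ℂ) = _
    rw [AddCircle.toCircle_apply_mk, div_self Real.two_pi_pos.ne', one_mul, Circle.coe_exp]
  have h_integral : ∫ θ, h θ ∂AddCircle.haarAddCircle = ((∫ w, g w ∂circleUniform : ℝ) : ℂ) := by
    rw [AddCircle.integral_haarAddCircle, ← AddCircle.integral_preimage (2 * Real.pi) 0,
      circleUniform, integral_smul_measure, integral_map (by fun_prop)
        g.continuous.aestronglyMeasurable, ENNReal.toReal_inv,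
      ENNReal.toReal_ofReal Real.two_pi_pos.le, zero_add]
    simp_rw [hcoe]
    rw [integral_complex_ofReal, Complex.real_smul, smul_eq_mul, Complex.ofReal_mul]
  have hmain := tendsto_average_arg hcard hz hpow h
  rw [h_integral] at hmain
  have hre := (Complex.continuous_re.tendsto _).comp hmain
  rw [Complex.ofReal_re] at hre
  have hsum := hre.add (tendsto_average_sub_normalize hcard hz hlog g)
  rw [add_zero] at hsum
  refine hsum.congr' ?_
  filter_upwards [hz] with n hn
  have hexp : ∀ i, Complex.exp ((z n i).arg * Complex.I) = z n i / ‖z n i‖ := by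
    intro i
    rw [eq_div_iff (by simpa using hn i), mul_comm]
    exact Complex.norm_mul_exp_arg_mul_I _
  simp only [Function.comp, hcoe, hexp]
  rw [← Complex.ofReal_sum, ← Complex.ofReal_natCast, ← Complex.ofReal_inv, ← Complex.ofReal_mul,
    Complex.ofReal_re, ← mul_add, ← sum_add_distrib]
  simp

theorem integral_rootMeasure (f : Polynomial ℂ) (g : BoundedContinuousFunction ℂ ℝ) :
    ∫ z, g z ∂(rootMeasure f) = (f.natDegree : ℝ)⁻¹ * ∑ i : f.roots, g i := by
  have h : ∀ s : Multiset ℂ, IsFiniteMeasure (s.map Measure.dirac).sum ∧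
      ∫ z, g z ∂(s.map Measure.dirac).sum = (s.map g).sum := by
    intro s
    induction s using Multiset.induction_on with
    | empty =>
      simp only [Multiset.map_zero, Multiset.sum_zero, integral_zero_measure]
      exact ⟨inferInstance, trivial⟩
    | cons a s ih =>
      have := ih.1
      simp only [Multiset.map_cons, Multiset.sum_cons]
      refine ⟨inferInstance, ?_⟩
      rw [integral_add_measure (g.integrable _) (g.integrable _), integral_dirac, ih.2]
  rw [rootMeasure, integral_smul_measure, (h _).2, Finset.sum, Multiset.map_univ]
  simp

theorem coeff_crankPrincipal_zero (n : ℕ) :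
    (crankPrincipal n).coeff 0 = (crankCount 0 n : ℂ) / 2 := by
  rw [crankPrincipal, Polynomial.coeff_add, Polynomial.coeff_C_zero, Polynomial.finsetSum_coeff,
    sum_eq_zero, add_zero]
  intro m hm
  rw [Polynomial.coeff_C_mul_X_pow, if_neg]
  have := (mem_Icc.1 hm).1
  omega

theorem coeff_crankPrincipal_of_ne_zero {m : ℕ} (hm : m ≠ 0) (n : ℕ) :
    (crankPrincipal n).coeff m = if m ≤ n then (crankCount m n : ℂ) else 0 := by
  rw [crankPrincipal, Polynomial.coeff_add, Polynomial.coeff_C, if_neg hm, zero_add,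
    Polynomial.finsetSum_coeff]
  simp only [Polynomial.coeff_C_mul_X_pow]
  rw [Finset.sum_ite_eq]
  simp [Nat.one_le_iff_ne_zero, hm]

theorem crankCount_self {n : ℕ} (hn : 2 ≤ n) : crankCount n n = 1 := by
  rw [crankCount, Nat.card_eq_one_iff_unique]
  have hpart : (Nat.Partition.indiscrete n).parts = {n} :=
    Nat.Partition.indiscrete_parts (by omega)
  refine ⟨⟨?_⟩, ⟨⟨Nat.Partition.indiscrete n, ?_⟩⟩⟩
  · suffices H : ∀ π : Nat.Partition n, partitionCrank π = n → π.parts = {n} by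
      rintro ⟨π, hπ⟩ ⟨ρ, hρ⟩
      exact Subtype.ext (Nat.Partition.ext ((H π hπ).trans (H ρ hρ).symm))
    intro π hπ
    have hmem : n ∈ π.parts := by
      rw [partitionCrank] at hπ
      split_ifs at hπ with h1
      swap
      · by_contra hcon
        have hlt : ∀ a ∈ π.parts, a ≤ n - 1 := by
          intro a ha
          have := π.le_of_mem_parts ha
          have : a ≠ n := fun h => hcon (h ▸ ha)
          omega
        have : π.parts.sup ≤ n - 1 := Multiset.sup_le.2 hlt
        have : π.parts.sup = n := by exact_mod_cast hπ
        omega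
      · exfalso
        have hc : 0 < π.parts.count 1 := Multiset.count_pos.2 h1
        have h2 : (π.parts.filter (fun a => π.parts.count 1 < a)).card ≤ π.parts.card :=
          Multiset.card_le_card (Multiset.filter_le _ _)
        have h3 : π.parts.card ≤ n := by
          have := Multiset.card_nsmul_le_sum (s := π.parts) (a := 1) fun x hx => π.parts_pos hx
          rw [π.parts_sum] at this
          simpa using this
        omega
    obtain ⟨t, ht⟩ := Multiset.exists_cons_of_mem hmem
    have hs := π.parts_sum
    rw [ht, Multiset.sum_cons] at hs
    have ht0 : t = 0 := by
      refine Multiset.eq_zero_of_forall_notMem fun a ha => ?_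
      have h1 := Multiset.le_sum_of_mem ha
      have h2 : 0 < a := π.parts_pos (by rw [ht]; exact Multiset.mem_cons_of_mem ha)
      omega
    rw [ht, ht0]
    rfl
  · rw [partitionCrank, hpart, if_pos (by simp; omega)]
    simp

theorem crankCount_zero_pos {n : ℕ} (hn : 3 ≤ n) : 0 < crankCount 0 n := by
  rw [crankCount, Nat.card_pos_iff]
  let π : Nat.Partition n := ⟨{n - 1, 1}, by
    intro i hi
    simp at hi
    omega, by simp; omega⟩
  have hparts : π.parts = {n - 1, 1} := rfl
  refine ⟨⟨⟨π, ?_⟩⟩, inferInstance⟩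
  have hc : ({n - 1, 1} : Multiset ℕ).count 1 = 1 := by
    rw [Multiset.insert_eq_cons, Multiset.count_cons, Multiset.count_singleton_self, if_neg]
    omega
  rw [partitionCrank, hparts, if_neg (by simp), hc, Multiset.insert_eq_cons,
    Multiset.filter_cons_of_pos _ (by omega), Multiset.filter_singleton]
  simp

theorem sum_crankCount_le (n : ℕ) :
    ∑ m ∈ range (n + 1), crankCount m n ≤ Fintype.card (Nat.Partition n) := by
  classical
  have h : ∀ m : ℕ, crankCount m n =
      #{π ∈ (univ : Finset (Nat.Partition n)) | partitionCrank π = m} := fun m => by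
    rw [crankCount, Nat.card_eq_fintype_card, Fintype.card_subtype]
  simp_rw [h]
  rw [← card_biUnion]
  · exact card_le_univ _
  · intro a _ b _ hab
    refine disjoint_left.2 fun π ha hb => hab ?_
    have h1 := (mem_filter.1 ha).2
    have h2 := (mem_filter.1 hb).2
    exact_mod_cast h1.symm.trans h2

theorem natDegree_crankPrincipal {n : ℕ} (hn : 2 ≤ n) : (crankPrincipal n).natDegree = n := by
  refine Polynomial.natDegree_eq_of_le_of_coeff_ne_zero ?_ ?_
  · refine Polynomial.natDegree_le_iff_coeff_eq_zero.2 fun m hm => ?_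
    rw [coeff_crankPrincipal_of_ne_zero (by omega), if_neg (by omega)]
  · rw [coeff_crankPrincipal_of_ne_zero (by omega), if_pos le_rfl, crankCount_self hn]
    simp

theorem leadingCoeff_crankPrincipal {n : ℕ} (hn : 2 ≤ n) : (crankPrincipal n).leadingCoeff = 1 := by
  rw [Polynomial.leadingCoeff, natDegree_crankPrincipal hn,
    coeff_crankPrincipal_of_ne_zero (by omega), if_pos le_rfl, crankCount_self hn]
  simp

theorem half_le_norm_coeff_zero_crankPrincipal {n : ℕ} (hn : 3 ≤ n) :
    1 / 2 ≤ ‖(crankPrincipal n).coeff 0‖ := by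
  rw [coeff_crankPrincipal_zero, norm_div, Complex.norm_natCast, Complex.norm_two]
  have : (1 : ℝ) ≤ crankCount 0 n := by exact_mod_cast crankCount_zero_pos hn
  linarith

theorem sum_norm_coeff_crankPrincipal_le {n : ℕ} (hn : 2 ≤ n) :
    (crankPrincipal n).sum (fun _ a => ‖a‖) ≤ Fintype.card (Nat.Partition n) := by
  rw [Polynomial.sum_over_range _ (by simp), natDegree_crankPrincipal hn]
  refine le_trans (sum_le_sum (g := fun m : ℕ => (crankCount m n : ℝ)) fun m hm => ?_)
    (by exact_mod_cast sum_crankCount_le n)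
  rcases eq_or_ne m 0 with rfl | hm0
  · rw [coeff_crankPrincipal_zero, norm_div, Complex.norm_natCast, Complex.norm_two]
    exact half_le_self (Nat.cast_nonneg _)
  · rw [coeff_crankPrincipal_of_ne_zero hm0, if_pos (by simpa [Nat.lt_succ_iff] using hm),
      Complex.norm_natCast]

/-- **Theorem 4.2 (crank part):** as `n → ∞`, the empirical root measures of the crank
principal polynomials `M_n(w)` converge weakly to the uniform probability measure on the
unit circle. -/
theorem crankPrincipal_roots_equidistribute :
    ∀ g : BoundedContinuousFunction ℂ ℝ,
      Tendsto (fun n : ℕ => ∫ z, g z ∂(rootMeasure (crankPrincipal n))) atTop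
        (nhds (∫ z, g z ∂circleUniform)) := by
  intro g
  have hdeg : ∀ᶠ n in atTop, Fintype.card (crankPrincipal n).roots = n := by
    filter_upwards [eventually_ge_atTop 2] with n hn
    rw [Multiset.card_coe, ← (IsAlgClosed.splits _).natDegree_eq_card_roots,
      natDegree_crankPrincipal hn]
  set A : ℕ → ℝ := fun n => Real.log (2 * Fintype.card (Nat.Partition n)) with hA
  have hlim : ∀ c : ℝ, Tendsto (fun n : ℕ => c * (A n / n)) atTop (nhds 0) := fun c => by
    simpa using tendsto_log_card_partition_div.const_mul c
  have hone : ∀ n : ℕ, (1 : ℝ) ≤ Fintype.card (Nat.Partition n) := fun n => by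
    exact_mod_cast Fintype.card_pos
  have hne : ∀ n, 3 ≤ n → ∀ i : (crankPrincipal n).roots, (i : ℂ) ≠ 0 := fun n hn =>
    coe_roots_ne_zero (norm_pos_iff.1 (by linarith [half_le_norm_coeff_zero_crankPrincipal hn]))
  have key := tendsto_average_of_tendsto_power_sums (l := atTop)
    (ι := fun n => ((crankPrincipal n).roots : Type)) (z := fun n i => (i : ℂ)) ?_ ?_ ?_ ?_ g
  · refine key.congr' ?_
    filter_upwards [hdeg, eventually_ge_atTop 2] with n hn h2
    rw [integral_rootMeasure, hn, natDegree_crankPrincipal h2]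
  · filter_upwards [hdeg, eventually_gt_atTop 0] with n hn h0
    rwa [hn]
  · filter_upwards [eventually_ge_atTop 3] with n hn
    exact hne n hn
  · refine squeeze_zero' (Eventually.of_forall fun n => by positivity) ?_ (hlim 2)
    filter_upwards [hdeg, eventually_ge_atTop 3] with n hn h3
    rw [hn]
    have := sum_abs_log_norm_roots_le (leadingCoeff_crankPrincipal (by omega))
      (half_le_norm_coeff_zero_crankPrincipal h3)
      (sum_norm_coeff_crankPrincipal_le (by omega)) (hone n)
    calc _ ≤ (n : ℝ)⁻¹ * (2 * A n) := by gcongr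
      _ = _ := by ring
  · intro k hk
    refine squeeze_zero_norm' ?_ (hlim (4 * k))
    filter_upwards [hdeg, eventually_ge_atTop 3] with n hn h3
    have hApos : 0 < A n := Real.log_pos (by linarith [hone n])
    rw [hn, norm_mul, norm_inv, Complex.norm_natCast]
    have := norm_sum_pow_le_of_prod_norm_sub_le
      (u := fun i : (crankPrincipal n).roots => (i : ℂ) / ‖(i : ℂ)‖) (fun i => by
        rw [norm_div, Complex.norm_real, norm_norm, div_self (norm_ne_zero_iff.2 (hne n h3 i))])
      hApos (fun z hz => by
        rw [hA, Real.exp_log (by linarith [hone n])]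
        exact prod_norm_sub_normalized_roots_le (leadingCoeff_crankPrincipal (by omega))
          (half_le_norm_coeff_zero_crankPrincipal h3)
          (sum_norm_coeff_crankPrincipal_le (by omega)) (hone n) hz) hk
    calc _ ≤ (n : ℝ)⁻¹ * (4 * (k * A n)) := by gcongr
      _ = _ := by ring
end

section
/- As n → ∞, the empirical root measures μ_{Q_n} of the unimodal rank principal polynomials Q_n(w) converge weakly to ν, the uniform probability measure on the unit circle; that is, the roots of Q_n(w) tend to equidistribution on the unit circle. -/
open Finset MeasureTheory Filter

/-- A (weakly) unimodal sequence of size `n` with a distinguished peak: a sequence of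
positive integers `a₁ ≤ ⋯ ≤ a_{k−1} ≤ a_k ≥ a_{k+1} ≥ ⋯ ≥ a_s` of total sum `n`, with a
distinguished occurrence `a_k` of the maximal part. Since the parts on each side of the
peak appear in a prescribed (sorted) order, such a sequence is equivalently a triple
consisting of the peak value, the multiset of parts strictly to the left of the peak, and
the multiset of parts strictly to the right of the peak, all parts positive and at most
the peak. (Sequences with a repeated maximal part arise once for each possible location
of the peak.) -/
structure UnimodalSeq (n : ℕ) where
  peak : ℕ
  left : Multiset ℕ
  right : Multiset ℕ
  peak_pos : 0 < peak
  left_pos : ∀ a ∈ left, 0 < a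
  right_pos : ∀ a ∈ right, 0 < a
  left_le : ∀ a ∈ left, a ≤ peak
  right_le : ∀ a ∈ right, a ≤ peak
  sum_eq : peak + left.sum + right.sum = n

/-- The rank of a unimodal sequence: the number of parts strictly to the right of the
peak minus the number of parts strictly to the left of the peak. -/
def UnimodalSeq.rank {n : ℕ} (s : UnimodalSeq n) : ℤ :=
  (Multiset.card s.right : ℤ) - Multiset.card s.left

/-- `u(m,n)`: the number of unimodal sequences of size `n` with rank `m`. -/
noncomputable def unimodalCount (m : ℤ) (n : ℕ) : ℕ :=
  Nat.card {s : UnimodalSeq n // s.rank = m}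

/-- The unimodal rank principal polynomial
`Q_n(w) = u(0,n)/2 + ∑_{1 ≤ m < n} u(m,n) wᵐ`. -/
noncomputable def unimodalPrincipal (n : ℕ) : Polynomial ℂ :=
  Polynomial.C ((unimodalCount 0 n : ℂ) / 2) +
    ∑ m ∈ Finset.Ico 1 n, Polynomial.C ((unimodalCount m n : ℕ) : ℂ) * Polynomial.X ^ m

/-- The multisets of positive integers with sum at most `k`. -/
def smallMultisets (k : ℕ) : Set (Multiset ℕ) := {s | (∀ a ∈ s, 0 < a) ∧ s.sum ≤ k}

lemma Multiset.sum_eq_sum_fin_count {k : ℕ} {s : Multiset ℕ} (hs : s ∈ smallMultisets k) :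
    s.sum = ∑ j : Fin k, (j + 1 : ℕ) * s.count (j + 1 : ℕ) := by
  have hsub : s.toFinset ⊆ Finset.Ico 1 (k + 1) := by
    intro a ha
    have ha' := Multiset.mem_toFinset.1 ha
    have h1 := hs.1 a ha'
    have h2 := (Multiset.le_sum_of_mem ha').trans hs.2
    rw [Finset.mem_Ico]; omega
  rw [Finset.sum_multiset_count_of_subset s _ hsub, Finset.sum_Ico_eq_sum_range,
    Fin.sum_univ_eq_sum_range (fun j => (j + 1) * s.count (j + 1)) k]
  simp [add_comm, mul_comm]

lemma count_le_of_mem_smallMultisets {k : ℕ} {s : Multiset ℕ} (hs : s ∈ smallMultisets k)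
    (j : Fin k) : s.count (j + 1 : ℕ) ≤ k := by
  have h := Finset.single_le_sum (f := fun j : Fin k => (j + 1 : ℕ) * s.count (j + 1 : ℕ))
    (fun _ _ => Nat.zero_le _) (Finset.mem_univ j)
  rw [← Multiset.sum_eq_sum_fin_count hs] at h
  have h2 := hs.2
  nlinarith [Nat.zero_le ((j : ℕ) * s.count (j + 1 : ℕ))]

lemma count_injOn_smallMultisets (k : ℕ) :
    Set.InjOn (fun (s : Multiset ℕ) (j : Fin k) => s.count (j + 1 : ℕ)) (smallMultisets k) := by
  intro s hs t ht hst
  ext a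
  have hlarge : ∀ u ∈ smallMultisets k, k < a → u.count a = 0 := fun u hu hk =>
    Multiset.count_eq_zero_of_notMem fun ha =>
      absurd ((Multiset.le_sum_of_mem ha).trans hu.2) (by omega)
  have hzero : ∀ u ∈ smallMultisets k, a = 0 → u.count a = 0 := fun u hu h0 =>
    Multiset.count_eq_zero_of_notMem fun ha => absurd (hu.1 a ha) (by omega)
  rcases Nat.eq_zero_or_pos a with h0 | h0
  · rw [hzero s hs h0, hzero t ht h0]
  rcases lt_or_ge k a with hk | hk
  · rw [hlarge s hs hk, hlarge t ht hk]
  have h := congrFun hst ⟨a - 1, by omega⟩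
  simpa [Nat.sub_add_cancel h0] using h

lemma finite_smallMultisets (k : ℕ) : (smallMultisets k).Finite := by
  refine Set.Finite.of_finite_image (f := fun s (j : Fin k) => s.count (j + 1 : ℕ)) ?_
    (count_injOn_smallMultisets k)
  refine (Fintype.piFinset fun _ : Fin k => Finset.range (k + 1)).finite_toSet.subset ?_
  rintro _ ⟨s, hs, rfl⟩
  simpa [Nat.lt_succ_iff] using count_le_of_mem_smallMultisets hs

lemma geom_sum_le_exp {x : ℝ} (hx0 : 0 ≤ x) (hx1 : x < 1) (j k : ℕ) :
    ∑ m ∈ Finset.range (k + 1), x ^ ((j + 1) * m) ≤ Real.exp (x ^ (j + 1) / (1 - x)) := by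
  have hy0 : 0 ≤ x ^ (j + 1) := by positivity
  have hyx : x ^ (j + 1) ≤ x := by
    rw [pow_succ]; exact mul_le_of_le_one_left hx0 (pow_le_one₀ hx0 hx1.le)
  have hy1 : x ^ (j + 1) < 1 := hyx.trans_lt hx1
  have h : ∑ m ∈ Finset.range (k + 1), x ^ ((j + 1) * m) ≤ (1 - x ^ (j + 1))⁻¹ := by
    simp_rw [pow_mul]
    rw [← tsum_geometric_of_lt_one hy0 hy1]
    exact (summable_geometric_of_lt_one hy0 hy1).sum_le_tsum _ fun _ _ => by positivity
  calc _ ≤ (1 - x ^ (j + 1))⁻¹ := h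
    _ = x ^ (j + 1) / (1 - x ^ (j + 1)) + 1 := by
      have : 1 - x ^ (j + 1) ≠ 0 := by linarith
      field_simp
      ring
    _ ≤ x ^ (j + 1) / (1 - x) + 1 := by
      gcongr
    _ ≤ _ := Real.add_one_le_exp _

lemma card_smallMultisets_mul_pow_le {x : ℝ} (hx0 : 0 ≤ x) (hx1 : x < 1) (k : ℕ) :
    (Nat.card (smallMultisets k) : ℝ) * x ^ k ≤ Real.exp (x / (1 - x) ^ 2) := by
  classical
  have hfin := finite_smallMultisets k
  calc (Nat.card (smallMultisets k) : ℝ) * x ^ k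
      = ∑ s ∈ hfin.toFinset, x ^ k := by
        rw [Finset.sum_const, nsmul_eq_mul, Nat.card_coe_set_eq, Set.ncard_eq_toFinset_card _ hfin]
    _ ≤ ∑ s ∈ hfin.toFinset, ∏ j : Fin k, x ^ ((j + 1 : ℕ) * s.count (j + 1 : ℕ)) := by
        refine Finset.sum_le_sum fun s hs => ?_
        have hs' : s ∈ smallMultisets k := by simpa using hs
        rw [Finset.prod_pow_eq_pow_sum, ← Multiset.sum_eq_sum_fin_count hs']
        exact pow_le_pow_of_le_one hx0 hx1.le hs'.2
    _ = ∑ f ∈ hfin.toFinset.image (fun s (j : Fin k) => s.count (j + 1 : ℕ)),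
          ∏ j : Fin k, x ^ ((j + 1 : ℕ) * f j) := by
        rw [Finset.sum_image]
        simpa using count_injOn_smallMultisets k
    _ ≤ ∑ f ∈ Fintype.piFinset fun _ : Fin k => Finset.range (k + 1),
          ∏ j : Fin k, x ^ ((j + 1 : ℕ) * f j) := by
        refine Finset.sum_le_sum_of_subset_of_nonneg ?_ fun _ _ _ => by positivity
        intro f hf
        obtain ⟨s, hs, rfl⟩ := Finset.mem_image.1 hf
        simpa [Nat.lt_succ_iff] using count_le_of_mem_smallMultisets (k := k) (by simpa using hs)
    _ = ∏ j : Fin k, ∑ m ∈ Finset.range (k + 1), x ^ ((j + 1 : ℕ) * m) := by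
        rw [Finset.prod_univ_sum]
    _ ≤ ∏ j : Fin k, Real.exp (x ^ (j + 1 : ℕ) / (1 - x)) :=
        Finset.prod_le_prod (fun _ _ => by positivity) fun j _ => geom_sum_le_exp hx0 hx1 j k
    _ = Real.exp ((∑ j ∈ Finset.range k, x ^ j) * (x / (1 - x))) := by
        rw [← Real.exp_sum, Fin.sum_univ_eq_sum_range (fun j => x ^ (j + 1) / (1 - x)) k,
          Finset.sum_mul]
        congr 1
        exact Finset.sum_congr rfl fun j _ => by ring
    _ ≤ Real.exp ((1 - x)⁻¹ * (x / (1 - x))) := by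
        have h1 : 0 < 1 - x := by linarith
        gcongr
        rw [← tsum_geometric_of_lt_one hx0 hx1]
        exact (summable_geometric_of_lt_one hx0 hx1).sum_le_tsum _ fun _ _ => by positivity
    _ = _ := by congr 1; field_simp

@[ext]
lemma UnimodalSeq.ext {n : ℕ} {s t : UnimodalSeq n} (hp : s.peak = t.peak)
    (hl : s.left = t.left) (hr : s.right = t.right) : s = t := by
  cases s; cases t; congr

lemma Multiset.filter_add_replicate_one {s : Multiset ℕ} (hs : ∀ a ∈ s, 0 < a) :
    s = s.filter (1 < ·) + Multiset.replicate (s.count 1) 1 := by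
  conv_lhs => rw [← Multiset.filter_add_not (1 < ·) s]
  congr 1
  rw [← Multiset.filter_eq']
  refine Multiset.filter_congr fun a ha => ?_
  have := hs a ha
  omega

lemma Multiset.card_add_sum_filter_le {s : Multiset ℕ} (hs : ∀ a ∈ s, 0 < a) :
    2 * card s + (s.filter (1 < ·)).sum ≤ 2 * s.sum := by
  induction s using Multiset.induction with
  | empty => simp
  | cons a s ih =>
    have h1 := hs a (by simp)
    have h2 := ih fun b hb => hs b (by simp [hb])
    by_cases h : 1 < a <;> simp [h] <;> omega

lemma Multiset.card_le_sum_of_pos {s : Multiset ℕ} (hs : ∀ a ∈ s, 0 < a) :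
    card s ≤ s.sum := by
  have := card_add_sum_filter_le hs
  omega

/-- A unimodal sequence of size `n` and rank at least `n - 1 - k` is encoded by its peak, its
left part, and the entries of its right part that are larger than `1`. -/
def UnimodalSeq.code {n k : ℕ} {m : ℤ} (hm : (n : ℤ) ≤ m + 1 + k)
    (s : {s : UnimodalSeq n // s.rank = m}) :
    Fin (k + 1) × smallMultisets (2 * k) × smallMultisets (2 * k) :=
  have hL := Multiset.card_le_sum_of_pos s.1.left_pos
  have hR := Multiset.card_add_sum_filter_le s.1.right_pos
  have hsum := s.1.sum_eq
  have hrank : (Multiset.card s.1.right : ℤ) - Multiset.card s.1.left = m := s.2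
  have hp := s.1.peak_pos
  ⟨⟨s.1.peak - 1, by omega⟩, ⟨s.1.left, s.1.left_pos, by omega⟩,
    ⟨s.1.right.filter (1 < ·),
      fun a ha => s.1.right_pos a (Multiset.mem_of_mem_filter ha), by omega⟩⟩

lemma UnimodalSeq.code_injective {n k : ℕ} {m : ℤ} (hm : (n : ℤ) ≤ m + 1 + k) :
    Function.Injective (UnimodalSeq.code hm) := by
  rintro ⟨s, hs⟩ ⟨t, ht⟩ h
  simp only [code, Prod.mk.injEq, Fin.mk.injEq] at h
  obtain ⟨h1, h2, h3⟩ := h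
  replace h2 : s.left = t.left := congrArg Subtype.val h2
  replace h3 := congrArg Subtype.val h3
  simp only at h3
  have hp : s.peak = t.peak := by
    have := s.peak_pos
    have := t.peak_pos
    omega
  have hs1 := Multiset.filter_add_replicate_one s.right_pos
  have ht1 := Multiset.filter_add_replicate_one t.right_pos
  have hcount : s.right.count 1 = t.right.count 1 := by
    have hs2 := congrArg Multiset.sum hs1
    have ht2 := congrArg Multiset.sum ht1
    simp only [Multiset.sum_add, Multiset.sum_replicate, smul_eq_mul, mul_one] at hs2 ht2
    have := s.sum_eq
    have := t.sum_eq
    rw [h3] at hs2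
    rw [← h2] at this
    omega
  refine Subtype.ext (UnimodalSeq.ext hp h2 ?_)
  rw [hs1, ht1, hcount, h3]

instance finite_smallMultisets_coe (k : ℕ) : Finite (smallMultisets k) :=
  (finite_smallMultisets k).to_subtype

lemma unimodalCount_le {n k : ℕ} {m : ℤ} (hm : (n : ℤ) ≤ m + 1 + k) :
    unimodalCount m n ≤ (k + 1) * Nat.card (smallMultisets (2 * k)) ^ 2 := by
  refine (Nat.card_le_card_of_injective _ (UnimodalSeq.code_injective hm)).trans_eq ?_
  simp [Nat.card_prod, sq]

lemma one_le_unimodalCount {n : ℕ} {m : ℤ} (s : UnimodalSeq n) (hs : s.rank = m) :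
    1 ≤ unimodalCount m n := by
  have hm : (n : ℤ) ≤ m + 1 + (n - 1 - m).toNat := by omega
  have := Finite.of_injective _ (UnimodalSeq.code_injective hm)
  have : Nonempty {s : UnimodalSeq n // s.rank = m} := ⟨⟨s, hs⟩⟩
  exact Nat.card_pos

lemma one_le_unimodalCount_zero {n : ℕ} (hn : 1 ≤ n) : 1 ≤ unimodalCount 0 n :=
  one_le_unimodalCount ⟨n, 0, 0, hn, by simp, by simp, by simp, by simp, by simp⟩
    (by simp [UnimodalSeq.rank])

lemma unimodalCount_pred {n : ℕ} (hn : 1 ≤ n) : unimodalCount ((n - 1 : ℕ) : ℤ) n = 1 := by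
  refine le_antisymm ?_ (one_le_unimodalCount
    ⟨1, 0, Multiset.replicate (n - 1) 1, one_pos, by simp, ?_, by simp, ?_, by simp; omega⟩
    (by simp [UnimodalSeq.rank]))
  · refine (unimodalCount_le (k := 0) (by omega)).trans ?_
    have : smallMultisets (2 * 0) ⊆ {0} := by
      rintro s ⟨h1, h2⟩
      have := Multiset.card_le_sum_of_pos h1
      simpa using Multiset.card_eq_zero.1 (by omega)
    have h := Set.ncard_le_ncard this
    simp only [Set.ncard_singleton] at h
    rw [Nat.card_coe_set_eq]
    have := Nat.pow_le_pow_left h 2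
    simpa using this
  · intro a ha
    rw [Multiset.eq_of_mem_replicate ha]; norm_num
  · intro a ha
    rw [Multiset.eq_of_mem_replicate ha]

lemma exists_unimodalCount_le {r : ℝ} (hr : 1 < r) :
    ∃ C : ℝ, 0 ≤ C ∧ ∀ (n k : ℕ) (m : ℤ), (n : ℤ) ≤ m + 1 + k →
      (unimodalCount m n : ℝ) ≤ C * r ^ k := by
  set ρ : ℝ := r ^ (1 / 5 : ℝ) with hρ
  have hρ1 : 1 < ρ := Real.one_lt_rpow hr (by norm_num)
  have hρr : ρ ^ 5 = r := by
    rw [hρ, ← Real.rpow_natCast, ← Real.rpow_mul (by linarith)]; norm_num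
  set x := ρ⁻¹ with hx
  have hx0 : 0 < x := by positivity
  have hx1 : x < 1 := inv_lt_one_of_one_lt₀ hρ1
  have hρx : ρ * x = 1 := mul_inv_cancel₀ (by positivity)
  set A := Real.exp (x / (1 - x) ^ 2) with hA
  have h1x : 0 < 1 - x := by linarith
  refine ⟨(1 - x)⁻¹ * A ^ 2, by positivity, fun n k m hm => ?_⟩
  have hT : (Nat.card (smallMultisets (2 * k)) : ℝ) ≤ A * ρ ^ (2 * k) := by
    have h := card_smallMultisets_mul_pow_le hx0.le hx1 (2 * k)
    calc (Nat.card (smallMultisets (2 * k)) : ℝ)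
        = Nat.card (smallMultisets (2 * k)) * x ^ (2 * k) * ρ ^ (2 * k) := by
          rw [mul_assoc, ← mul_pow, mul_comm x, hρx, one_pow, mul_one]
      _ ≤ _ := by gcongr
  have hk : (k + 1 : ℝ) ≤ (1 - x)⁻¹ * ρ ^ k := by
    have h : ∑ j ∈ Finset.range (k + 1), x ^ k ≤ (1 - x)⁻¹ := by
      rw [← tsum_geometric_of_lt_one hx0.le hx1]
      refine le_trans (Finset.sum_le_sum fun j hj => ?_)
        ((summable_geometric_of_lt_one hx0.le hx1).sum_le_tsum (Finset.range (k + 1))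
          fun _ _ => by positivity)
      exact pow_le_pow_of_le_one hx0.le hx1.le (by simpa [Nat.lt_succ_iff] using hj)
    rw [Finset.sum_const, Finset.card_range, nsmul_eq_mul] at h
    push_cast at h
    calc (k + 1 : ℝ) = (k + 1) * x ^ k * ρ ^ k := by
          rw [mul_assoc, ← mul_pow, mul_comm x, hρx, one_pow, mul_one]
      _ ≤ _ := by gcongr
  have hu : (unimodalCount m n : ℝ) ≤ (k + 1) * (Nat.card (smallMultisets (2 * k)) : ℝ) ^ 2 := by
    exact_mod_cast unimodalCount_le hm
  calc (unimodalCount m n : ℝ) ≤ _ := hu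
    _ ≤ ((1 - x)⁻¹ * ρ ^ k) * (A * ρ ^ (2 * k)) ^ 2 := by gcongr
    _ = (1 - x)⁻¹ * A ^ 2 * (ρ ^ 5) ^ k := by ring
    _ = _ := by rw [hρr]

lemma coeff_unimodalPrincipal (n j : ℕ) :
    (unimodalPrincipal n).coeff j =
      if j = 0 then (unimodalCount 0 n : ℂ) / 2
      else if j < n then (unimodalCount j n : ℂ) else 0 := by
  simp only [unimodalPrincipal, Polynomial.coeff_add, Polynomial.finsetSum_coeff,
    Polynomial.coeff_C_mul_X_pow, Polynomial.coeff_C]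
  rcases Nat.eq_zero_or_pos j with rfl | hj
  · simp only [if_true, add_eq_left]
    exact Finset.sum_eq_zero fun m hm => if_neg (by simp at hm; omega)
  · rw [Finset.sum_ite_eq]
    have h1 : 1 ≤ j := hj
    simp [hj.ne', h1]

lemma unimodalPrincipal_coeff_pred {n : ℕ} (hn : 2 ≤ n) :
    (unimodalPrincipal n).coeff (n - 1) = 1 := by
  rw [coeff_unimodalPrincipal, if_neg (by omega), if_pos (by omega),
    unimodalCount_pred (by omega), Nat.cast_one]

lemma natDegree_unimodalPrincipal {n : ℕ} (hn : 2 ≤ n) :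
    (unimodalPrincipal n).natDegree = n - 1 := by
  refine Polynomial.natDegree_eq_of_le_of_coeff_ne_zero ?_ ?_
  · rw [Polynomial.natDegree_le_iff_coeff_eq_zero]
    intro N hN
    rw [coeff_unimodalPrincipal, if_neg (by omega), if_neg (by omega)]
  · rw [unimodalPrincipal_coeff_pred hn]; exact one_ne_zero

lemma monic_unimodalPrincipal {n : ℕ} (hn : 2 ≤ n) : (unimodalPrincipal n).Monic := by
  rw [Polynomial.Monic, Polynomial.leadingCoeff, natDegree_unimodalPrincipal hn,
    unimodalPrincipal_coeff_pred hn]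

lemma half_le_norm_coeff_zero_unimodalPrincipal {n : ℕ} (hn : 1 ≤ n) :
    1 / 2 ≤ ‖(unimodalPrincipal n).coeff 0‖ := by
  have h : (1 : ℝ) ≤ unimodalCount 0 n := by exact_mod_cast one_le_unimodalCount_zero hn
  rw [coeff_unimodalPrincipal, if_pos rfl, norm_div, Complex.norm_natCast]
  norm_num
  linarith

lemma exists_norm_coeff_unimodalPrincipal_le {r : ℝ} (hr : 1 < r) :
    ∃ C : ℝ, 0 ≤ C ∧ ∀ n : ℕ, 2 ≤ n → ∀ k ≤ n - 1,
      ‖(unimodalPrincipal n).coeff (n - 1 - k)‖ ≤ C * r ^ k := by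
  obtain ⟨C, hC0, hC⟩ := exists_unimodalCount_le hr
  refine ⟨C, hC0, fun n hn k hk => ?_⟩
  have h := hC n k ((n - 1 - k : ℕ) : ℤ) (by omega)
  rw [coeff_unimodalPrincipal]
  split_ifs with h0 h1
  · rw [h0, Nat.cast_zero] at h
    rw [norm_div, Complex.norm_natCast]
    have : (0 : ℝ) ≤ unimodalCount 0 n := by positivity
    norm_num
    linarith
  · rwa [Complex.norm_natCast]
  · rw [norm_zero]; positivity

/-- The arithmetic mean of `f` over the multiset `S`. -/
noncomputable def Multiset.mean {α E : Type*} [AddCommGroup E] [Module ℝ E] (S : Multiset α)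
    (f : α → E) : E :=
  (card S : ℝ)⁻¹ • (S.map f).sum

namespace Multiset

variable {α : Type*} (S : Multiset α)

lemma mean_add {E : Type*} [AddCommGroup E] [Module ℝ E] (f g : α → E) :
    S.mean (fun z => f z + g z) = S.mean f + S.mean g := by
  simp [mean, sum_map_add]

lemma mean_sub {E : Type*} [AddCommGroup E] [Module ℝ E] (f g : α → E) :
    S.mean (fun z => f z - g z) = S.mean f - S.mean g := by
  simp [mean, sum_map_sub, smul_sub]

lemma mean_const_mul {K : Type*} [Field K] [Algebra ℝ K] (c : K) (f : α → K) :
    S.mean (fun z => c * f z) = c * S.mean f := by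
  simp [mean, sum_map_mul_left]

lemma mean_const {S : Multiset α} (hS : S ≠ 0) {E : Type*} [AddCommGroup E] [Module ℝ E] (c : E) :
    S.mean (fun _ => c) = c := by
  have h : (card S : ℝ) ≠ 0 := by simpa using hS
  simp [mean, ← Nat.cast_smul_eq_nsmul ℝ, smul_smul, h]

lemma norm_mean_le {S : Multiset α} {E : Type*} [NormedAddCommGroup E] [NormedSpace ℝ E]
    {f : α → E} {F : α → ℝ} (h : ∀ z ∈ S, ‖f z‖ ≤ F z) : ‖S.mean f‖ ≤ S.mean F := by
  rw [mean, mean, norm_smul, smul_eq_mul, Real.norm_of_nonneg (by positivity)]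
  gcongr
  refine (norm_multiset_sum_le _).trans ?_
  rw [map_map]
  exact sum_map_le_sum_map _ _ h

lemma mean_mono {S : Multiset α} {f F : α → ℝ} (h : ∀ z ∈ S, f z ≤ F z) : S.mean f ≤ S.mean F := by
  rw [mean, mean, smul_eq_mul, smul_eq_mul]
  gcongr
  exact sum_map_le_sum_map _ _ h

lemma mean_conj (f : α → ℂ) :
    S.mean (fun z => (starRingEnd ℂ) (f z)) = (starRingEnd ℂ) (S.mean f) := by
  simp [mean, map_multiset_sum, map_map]

lemma mean_re (f : α → ℂ) : S.mean (fun z => (f z).re) = (S.mean f).re := by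
  have := map_multiset_sum Complex.reAddGroupHom (S.map f)
  simp only [map_map, Complex.coe_reAddGroupHom] at this
  simp [mean, this]

end Multiset

lemma tendsto_mean_of_norm_sub_le {E : Type*} [NormedAddCommGroup E] [NormedSpace ℝ E]
    {α : Type*} {S : ℕ → Multiset α} {f g : α → E} {φ : α → ℝ} {a : E}
    (hS : ∀ᶠ n in atTop, S n ≠ 0)
    (hφ : Tendsto (fun n => (S n).mean φ) atTop (nhds 0))
    (hfg : ∀ ε > 0, ∃ K, ∀ᶠ n in atTop, ∀ z ∈ S n, ‖f z - g z‖ ≤ ε + K * φ z)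
    (hg : Tendsto (fun n => (S n).mean g) atTop (nhds a)) :
    Tendsto (fun n => (S n).mean f) atTop (nhds a) := by
  have h : Tendsto (fun n => (S n).mean f - (S n).mean g) atTop (nhds 0) := by
    rw [tendsto_zero_iff_norm_tendsto_zero, Metric.tendsto_nhds]
    intro ε hε
    obtain ⟨K, hK⟩ := hfg (ε / 2) (half_pos hε)
    have h2 : Tendsto (fun n => ε / 2 + K * (S n).mean φ) atTop (nhds (ε / 2)) := by
      simpa using (hφ.const_mul K).const_add (ε / 2)
    filter_upwards [hK, hS, h2.eventually_lt_const (half_lt_self hε)] with n h1 h3 h4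
    rw [dist_zero_right, norm_norm, ← Multiset.mean_sub]
    refine (Multiset.norm_mean_le h1).trans_lt ?_
    rwa [Multiset.mean_add, Multiset.mean_const h3, Multiset.mean_const_mul]
  simpa using h.add hg

section Equidistribution

open Complex

local instance fact_two_pi_pos : Fact (0 < 2 * Real.pi) := ⟨Real.two_pi_pos⟩

lemma fourier_arg (k : ℤ) (z : ℂ) :
    fourier k ((arg z : ℝ) : AddCircle (2 * Real.pi)) = exp (arg z * I) ^ k := by
  rw [fourier_coe_apply, ← exp_int_mul]
  congr 1
  push_cast
  have : (Real.pi : ℂ) ≠ 0 := by exact_mod_cast Real.pi_ne_zero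
  field_simp

lemma integral_fourier_haarAddCircle (k : ℤ) :
    ∫ t : AddCircle (2 * Real.pi), fourier k t ∂AddCircle.haarAddCircle =
      if k = 0 then 1 else 0 := by
  have h := congrFun (fourierCoeff_fourier (T := 2 * Real.pi) k) 0
  simp only [fourierCoeff, neg_zero, fourier_zero, one_smul, Pi.single_apply] at h
  rw [h]
  simp [eq_comm]

lemma norm_exp_arg_pow_sub_pow_le {R : ℝ} {z : ℂ} (hz : ‖z‖ ≤ R) (k : ℕ) :
    ‖exp (arg z * I) ^ k - z ^ k‖ ≤ (∑ i ∈ Finset.range k, R ^ i) * |‖z‖ - 1| := by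
  have h : exp (arg z * I) ^ k - z ^ k = ((1 - ‖z‖ ^ k : ℝ) : ℂ) * exp (arg z * I) ^ k := by
    nth_rw 2 [← norm_mul_exp_arg_mul_I z]
    push_cast
    ring
  rw [h, norm_mul, norm_pow, norm_exp_ofReal_mul_I, one_pow, mul_one, norm_real, Real.norm_eq_abs,
    abs_sub_comm, ← geom_sum_mul, abs_mul, abs_of_nonneg (by positivity)]
  gcongr

variable {S : ℕ → Multiset ℂ} {R : ℝ}

lemma tendsto_mean_fourier (hS : ∀ᶠ n in atTop, S n ≠ 0)
    (hR : ∀ᶠ n in atTop, ∀ z ∈ S n, ‖z‖ ≤ R)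
    (hrad : Tendsto (fun n => (S n).mean fun z => |‖z‖ - 1|) atTop (nhds 0))
    (hpow : ∀ k : ℕ, 1 ≤ k → Tendsto (fun n => (S n).mean fun z => z ^ k) atTop (nhds 0))
    (k : ℤ) :
    Tendsto (fun n => (S n).mean fun z => fourier k ((arg z : ℝ) : AddCircle (2 * Real.pi)))
      atTop (nhds (∫ t : AddCircle (2 * Real.pi), fourier k t ∂AddCircle.haarAddCircle)) := by
  have hpos : ∀ k : ℕ, 1 ≤ k → Tendsto (fun n => (S n).mean fun z =>
      fourier (k : ℤ) ((arg z : ℝ) : AddCircle (2 * Real.pi))) atTop (nhds 0) := by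
    intro k hk
    refine tendsto_mean_of_norm_sub_le hS hrad (fun ε hε => ?_) (hpow k hk)
    refine ⟨∑ i ∈ Finset.range k, R ^ i, hR.mono fun n hn z hz => ?_⟩
    rw [fourier_arg, zpow_natCast]
    linarith [norm_exp_arg_pow_sub_pow_le (hn z hz) k]
  rw [integral_fourier_haarAddCircle]
  obtain ⟨m, rfl | rfl⟩ := k.eq_nat_or_neg
  · rcases Nat.eq_zero_or_pos m with rfl | hm
    · simp only [Nat.cast_zero, fourier_zero, if_true]
      exact tendsto_const_nhds.congr' (hS.mono fun n hn => (Multiset.mean_const hn 1).symm)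
    · rw [if_neg (by omega)]
      exact hpos m hm
  · rcases Nat.eq_zero_or_pos m with rfl | hm
    · simp only [Nat.cast_zero, neg_zero, fourier_zero, if_true]
      exact tendsto_const_nhds.congr' (hS.mono fun n hn => (Multiset.mean_const hn 1).symm)
    · rw [if_neg (by omega)]
      simp only [fourier_neg, Multiset.mean_conj]
      simpa only [Function.comp_def, map_zero] using
        (continuous_conj.tendsto 0).comp (hpos m hm)

lemma tendsto_mean_comp_arg (hS : ∀ᶠ n in atTop, S n ≠ 0)
    (hR : ∀ᶠ n in atTop, ∀ z ∈ S n, ‖z‖ ≤ R)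
    (hrad : Tendsto (fun n => (S n).mean fun z => |‖z‖ - 1|) atTop (nhds 0))
    (hpow : ∀ k : ℕ, 1 ≤ k → Tendsto (fun n => (S n).mean fun z => z ^ k) atTop (nhds 0))
    (f : C(AddCircle (2 * Real.pi), ℂ)) :
    Tendsto (fun n => (S n).mean fun z => f ((arg z : ℝ) : AddCircle (2 * Real.pi)))
      atTop (nhds (∫ t, f t ∂AddCircle.haarAddCircle)) := by
  have hint : ∀ h : C(AddCircle (2 * Real.pi), ℂ), Integrable h AddCircle.haarAddCircle :=
    fun h => h.continuous.integrable_of_hasCompactSupport (HasCompactSupport.of_compactSpace _)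
  have hspan : ∀ h ∈ Submodule.span ℂ (Set.range (fourier (T := 2 * Real.pi))),
      Tendsto (fun n => (S n).mean fun z => h ((arg z : ℝ) : AddCircle (2 * Real.pi)))
        atTop (nhds (∫ t, h t ∂AddCircle.haarAddCircle)) := by
    intro h hh
    induction hh using Submodule.span_induction with
    | mem h hh =>
      obtain ⟨k, rfl⟩ := hh
      exact tendsto_mean_fourier hS hR hrad hpow k
    | zero => simp [Multiset.mean]
    | add h₁ h₂ _ _ ih₁ ih₂ =>
      simp only [ContinuousMap.add_apply, Multiset.mean_add]
      rw [integral_add (hint h₁) (hint h₂)]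
      exact ih₁.add ih₂
    | smul c h _ ih =>
      simp only [ContinuousMap.smul_apply, smul_eq_mul, Multiset.mean_const_mul]
      rw [integral_const_mul]
      exact ih.const_mul c
  have hf : f ∈ closure (Submodule.span ℂ (Set.range (fourier (T := 2 * Real.pi))) :
      Set C(AddCircle (2 * Real.pi), ℂ)) := by
    rw [← Submodule.topologicalClosure_coe, span_fourier_closure_eq_top]
    trivial
  rw [Metric.tendsto_nhds]
  intro ε hε
  obtain ⟨h, hh, hfh⟩ := Metric.mem_closure_iff.1 hf (ε / 3) (by positivity)
  have hpt : ∀ t, ‖f t - h t‖ ≤ ε / 3 := fun t => by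
    rw [← dist_eq_norm]
    exact (ContinuousMap.dist_apply_le_dist t).trans hfh.le
  have hI : ‖∫ t, f t ∂AddCircle.haarAddCircle - ∫ t, h t ∂AddCircle.haarAddCircle‖ ≤ ε / 3 := by
    rw [← integral_sub (hint f) (hint h)]
    refine (norm_integral_le_of_norm_le_const (ae_of_all _ hpt)).trans_eq ?_
    simp
  filter_upwards [hS, Metric.tendsto_nhds.1 (hspan h hh) (ε / 3) (by positivity)] with n hn h1
  have h2 : ‖(S n).mean (fun z => f ((arg z : ℝ) : AddCircle (2 * Real.pi))) -
      (S n).mean (fun z => h ((arg z : ℝ) : AddCircle (2 * Real.pi)))‖ ≤ ε / 3 := by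
    rw [← Multiset.mean_sub]
    refine (Multiset.norm_mean_le fun z _ => hpt _).trans_eq ?_
    rw [Multiset.mean_const hn]
  rw [← dist_eq_norm] at h2 hI
  rw [dist_comm] at hI
  linarith [dist_triangle4 ((S n).mean fun z => f ((arg z : ℝ) : AddCircle (2 * Real.pi)))
    ((S n).mean fun z => h ((arg z : ℝ) : AddCircle (2 * Real.pi)))
    (∫ t, h t ∂AddCircle.haarAddCircle) (∫ t, f t ∂AddCircle.haarAddCircle)]

lemma norm_exp_arg_sub_self (z : ℂ) : ‖z - exp (arg z * I)‖ = |‖z‖ - 1| := by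
  have h : z - exp (arg z * I) = ((‖z‖ - 1 : ℝ) : ℂ) * exp (arg z * I) := by
    nth_rw 1 [← norm_mul_exp_arg_mul_I z]
    push_cast
    ring
  rw [h, norm_mul, norm_exp_ofReal_mul_I, mul_one, norm_real, Real.norm_eq_abs]

lemma integral_circleUniform (g : BoundedContinuousFunction ℂ ℝ) :
    ∫ z, g z ∂circleUniform =
      ∫ t : AddCircle (2 * Real.pi), g (AddCircle.toCircle t : ℂ) ∂AddCircle.haarAddCircle := by
  rw [AddCircle.integral_haarAddCircle, circleUniform, integral_smul_measure,
    integral_map (by fun_prop) (by fun_prop), ← AddCircle.intervalIntegral_preimage _ 0, zero_add,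
    intervalIntegral.integral_of_le Real.two_pi_pos.le, ENNReal.toReal_inv,
    ENNReal.toReal_ofReal Real.two_pi_pos.le]
  simp [AddCircle.toCircle_apply_mk, Circle.coe_exp]

/-- Multisets that concentrate near the unit circle and have power sums negligible compared to
their size are equidistributed on the unit circle. -/
lemma tendsto_mean_circleUniform (hS : ∀ᶠ n in atTop, S n ≠ 0)
    (hR : ∀ᶠ n in atTop, ∀ z ∈ S n, ‖z‖ ≤ R)
    (hrad : Tendsto (fun n => (S n).mean fun z => |‖z‖ - 1|) atTop (nhds 0))
    (hpow : ∀ k : ℕ, 1 ≤ k → Tendsto (fun n => (S n).mean fun z => z ^ k) atTop (nhds 0))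
    (g : BoundedContinuousFunction ℂ ℝ) :
    Tendsto (fun n => (S n).mean g) atTop (nhds (∫ z, g z ∂circleUniform)) := by
  set f : C(AddCircle (2 * Real.pi), ℂ) :=
    ⟨fun t => (g (AddCircle.toCircle t : ℂ) : ℂ), by fun_prop⟩ with hf
  have hcirc : ∀ z : ℂ, f ((arg z : ℝ) : AddCircle (2 * Real.pi)) = g (exp (arg z * I)) := by
    intro z
    simp [hf, AddCircle.toCircle_apply_mk, Circle.coe_exp]
  have hlim : Tendsto (fun n => (S n).mean fun z => g (exp (arg z * I))) atTop
      (nhds (∫ z, g z ∂circleUniform)) := by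
    have h := (continuous_re.tendsto _).comp (tendsto_mean_comp_arg hS hR hrad hpow f)
    simp only [Function.comp_def, ← Multiset.mean_re, hcirc, ofReal_re] at h
    convert h using 2
    rw [integral_circleUniform]
    exact (congrArg re (integral_ofReal (𝕜 := ℂ)
      (f := fun t : AddCircle (2 * Real.pi) => g (AddCircle.toCircle t : ℂ)))).symm
  refine tendsto_mean_of_norm_sub_le hS hrad (fun ε hε => ?_) hlim
  have huc : UniformContinuousOn g (Metric.closedBall 0 (max R 1)) :=
    (isCompact_closedBall _ _).uniformContinuousOn_of_continuous g.continuous.continuousOn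
  obtain ⟨δ, hδ, hδε⟩ := Metric.uniformContinuousOn_iff.1 huc ε hε
  refine ⟨2 * ‖g‖ / δ, hR.mono fun n hn z hz => ?_⟩
  have hK : 0 ≤ 2 * ‖g‖ / δ := by positivity
  rcases lt_or_ge |‖z‖ - 1| δ with h | h
  · have h1 := hδε z (by simpa using Or.inl (hn z hz)) (exp (arg z * I))
      (by simp [norm_exp_ofReal_mul_I]) (by rwa [dist_eq_norm, norm_exp_arg_sub_self])
    rw [dist_eq_norm] at h1
    nlinarith [abs_nonneg (‖z‖ - 1)]
  · calc ‖g z - g (exp (arg z * I))‖ ≤ 2 * ‖g‖ := by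
          simpa [dist_eq_norm] using g.dist_le_two_norm z (exp (arg z * I))
      _ = 2 * ‖g‖ / δ * δ := by field_simp
      _ ≤ 2 * ‖g‖ / δ * |‖z‖ - 1| := by gcongr
      _ ≤ _ := by linarith

end Equidistribution

lemma integral_rootMeasure_s18 (p : Polynomial ℂ) (g : BoundedContinuousFunction ℂ ℝ) :
    ∫ z, g z ∂rootMeasure p = p.roots.mean g := by
  have hsum : ∀ S : Multiset ℂ, Integrable g (S.map Measure.dirac).sum ∧
      ∫ z, g z ∂(S.map Measure.dirac).sum = (S.map g).sum := by
    intro S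
    induction S using Multiset.induction with
    | empty => simp
    | cons a S ih =>
      have ha : Integrable g (Measure.dirac a) := g.integrable _
      simp only [Multiset.map_cons, Multiset.sum_cons]
      refine ⟨ha.add_measure ih.1, ?_⟩
      rw [integral_add_measure ha ih.1, ih.2, integral_dirac]
  rw [rootMeasure, integral_smul_measure, (hsum _).2, Multiset.mean,
    (Polynomial.splits_iff_card_roots.1 (IsAlgClosed.splits p))]
  simp

lemma sum_map_pow_eq_esymm (S : Multiset ℂ) {k : ℕ} (hk : 0 < k) :
    (S.map (· ^ k)).sum = (-1) ^ (k + 1) * k * S.esymm k -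
      ∑ a ∈ Finset.HasAntidiagonal.antidiagonal k with a.1 ∈ Set.Ioo 0 k,
        (-1) ^ a.1 * S.esymm a.1 * (S.map (· ^ a.2)).sum := by
  obtain ⟨l, rfl⟩ := Quot.exists_rep S
  have hl : Multiset.map l.get Finset.univ.val = (l : Multiset ℂ) := by
    rw [Fin.univ_val_map, List.ofFn_get]
  have hp : ∀ m, MvPolynomial.aeval l.get (MvPolynomial.psum (Fin l.length) ℂ m) =
      ((l : Multiset ℂ).map (· ^ m)).sum := by
    intro m
    rw [← hl, Multiset.map_map]
    rw [MvPolynomial.psum, map_sum]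
    simp only [map_pow, MvPolynomial.aeval_X]
    rfl
  have h := congrArg (MvPolynomial.aeval l.get)
    (MvPolynomial.psum_eq_mul_esymm_sub_sum (Fin l.length) ℂ k hk)
  simp only [map_sub, map_mul, map_sum, map_pow, map_neg, map_one, map_natCast, hp,
    MvPolynomial.aeval_esymm_eq_multiset_esymm, hl] at h
  exact h

lemma exists_norm_sum_map_pow_le (E : ℕ → ℝ) (k : ℕ) :
    ∃ B : ℝ, ∀ S : Multiset ℂ, (∀ j, ‖S.esymm j‖ ≤ E j) → 0 < k →
      ‖(S.map (· ^ k)).sum‖ ≤ B := by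
  induction k using Nat.strong_induction_on with
  | _ k ih =>
    choose! B hB using ih
    refine ⟨k * E k + ∑ a ∈ Finset.HasAntidiagonal.antidiagonal k with a.1 ∈ Set.Ioo 0 k,
      E a.1 * B a.2, fun S hS hk => ?_⟩
    rw [sum_map_pow_eq_esymm S hk]
    refine (norm_sub_le _ _).trans (add_le_add ?_ ((norm_sum_le _ _).trans
      (Finset.sum_le_sum fun a ha => ?_)))
    · rw [norm_mul, norm_mul, norm_pow, norm_neg, norm_one, one_pow, one_mul,
        Complex.norm_natCast]
      gcongr
      exact hS k
    · rw [norm_mul, norm_mul, norm_pow, norm_neg, norm_one, one_pow, one_mul]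
      simp only [Finset.mem_filter, Finset.HasAntidiagonal.mem_antidiagonal, Set.mem_Ioo] at ha
      exact mul_le_mul (hS _) (hB _ (by omega) S hS (by omega)) (norm_nonneg _)
        ((norm_nonneg _).trans (hS _))

namespace Polynomial

variable {p : Polynomial ℂ} {C r : ℝ}

lemma norm_esymm_roots_le (hp : p.Monic) (hr : 0 ≤ r) (hC : 0 ≤ C)
    (hcoeff : ∀ k ≤ p.natDegree, ‖p.coeff (p.natDegree - k)‖ ≤ C * r ^ k) (j : ℕ) :
    ‖p.roots.esymm j‖ ≤ C * r ^ j := by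
  have hcard := splits_iff_card_roots.1 (IsAlgClosed.splits p)
  rcases le_or_gt j p.natDegree with hj | hj
  · have h := coeff_eq_esymm_roots_of_card hcard (Nat.sub_le p.natDegree j)
    rw [hp.leadingCoeff, one_mul, Nat.sub_sub_self hj] at h
    have h2 := hcoeff j hj
    rwa [h, norm_mul, norm_pow, norm_neg, norm_one, one_pow, one_mul] at h2
  · rw [Multiset.esymm, Multiset.powersetCard_eq_empty _ (by omega)]
    simp only [Multiset.map_zero, Multiset.sum_zero, norm_zero]
    positivity

lemma norm_root_le (hp : p.Monic) (hr : 0 ≤ r) (hC : 0 ≤ C)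
    (hcoeff : ∀ k ≤ p.natDegree, ‖p.coeff (p.natDegree - k)‖ ≤ C * r ^ k) {z : ℂ}
    (hz : p.IsRoot z) : ‖z‖ ≤ r * (1 + C) := by
  by_contra! hlt
  set d := p.natDegree with hd
  set t := ‖z‖ with ht
  set G := ∑ i ∈ Finset.range d, t ^ i * r ^ (d - 1 - i) with hG
  have hG0 : 0 ≤ G := by positivity
  have hgeom : G * (t - r) = t ^ d - r ^ d := (Commute.all t r).geom_sum₂_mul d
  have htpos : 0 < t := lt_of_le_of_lt (by positivity) hlt
  have hzd : z ^ d = -∑ i ∈ Finset.range d, p.coeff i * z ^ i := by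
    have h := hz
    rw [IsRoot, eval_eq_sum_range, Finset.sum_range_succ, ← hd, hd, hp.coeff_natDegree, ← hd,
      one_mul] at h
    exact eq_neg_of_add_eq_zero_right h
  have hle : t ^ d ≤ C * r * G := by
    calc t ^ d = ‖∑ i ∈ Finset.range d, p.coeff i * z ^ i‖ := by
          rw [ht, ← norm_pow, hzd, norm_neg]
      _ ≤ ∑ i ∈ Finset.range d, ‖p.coeff i * z ^ i‖ := norm_sum_le _ _
      _ ≤ ∑ i ∈ Finset.range d, C * r * (t ^ i * r ^ (d - 1 - i)) := by
          refine Finset.sum_le_sum fun i hi => ?_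
          have hi' : i < d := Finset.mem_range.1 hi
          have h1 := hcoeff (d - i) (by omega)
          rw [show d - (d - i) = i by omega, show d - i = d - 1 - i + 1 by omega] at h1
          rw [norm_mul, norm_pow]
          calc ‖p.coeff i‖ * t ^ i ≤ C * r ^ (d - 1 - i + 1) * t ^ i := by gcongr
            _ = _ := by ring
      _ = C * r * G := by rw [hG, Finset.mul_sum]
  have h0 : 0 < t ^ d := by positivity
  have hGpos : 0 < G := by
    by_contra! h
    have : G = 0 := le_antisymm h hG0
    rw [this] at hle
    linarith
  have hrd : 0 ≤ r ^ d := by positivity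
  nlinarith [mul_pos hGpos (by linarith : 0 < t - r * (1 + C))]

lemma sum_abs_log_norm_roots_le (hp : p.Monic) (h0 : p.coeff 0 ≠ 0) :
    (p.roots.map fun z => |Real.log ‖z‖|).sum ≤
      2 * Real.log (∑ i ∈ Finset.range (p.natDegree + 1), ‖p.coeff i‖) -
        Real.log ‖p.coeff 0‖ := by
  have hne : p ≠ 0 := hp.ne_zero
  have hroot : ∀ z ∈ p.roots, ‖z‖ ≠ 0 := by
    intro z hz hz0
    rw [norm_eq_zero] at hz0
    subst hz0
    exact h0 (by simpa [IsRoot, ← coeff_zero_eq_eval_zero] using isRoot_of_mem_roots hz)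
  have hpos : (p.roots.map fun z => Real.posLog ‖z‖).sum ≤
      Real.log (∑ i ∈ Finset.range (p.natDegree + 1), ‖p.coeff i‖) := by
    have h1 := logMahlerMeasure_eq_log_leadingCoeff_add_sum_log_roots p
    rw [hp.leadingCoeff, norm_one, Real.log_one, zero_add,
      logMahlerMeasure_eq_log_MahlerMeasure] at h1
    rw [← h1]
    refine Real.log_le_log (mahlerMeasure_pos_of_ne_zero hne) ?_
    refine (mahlerMeasure_le_sum_norm_coeff p).trans_eq ?_
    exact p.sum_over_range fun _ => norm_zero
  have hlog : (p.roots.map fun z => Real.log ‖z‖).sum = Real.log ‖p.coeff 0‖ := by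
    have h1 := (IsAlgClosed.splits p).coeff_zero_eq_prod_roots_of_monic hp
    have h2 := congrArg norm h1
    rw [norm_mul, norm_pow, norm_neg, norm_one, one_pow, one_mul] at h2
    have h3 : ‖p.roots.prod‖ = (p.roots.map norm).prod :=
      map_multiset_prod (normHom : ℂ →*₀ ℝ) p.roots
    rw [h2, h3, Real.log_multiset_prod, Multiset.map_map]
    · rfl
    · intro x hx
      obtain ⟨z, hz, rfl⟩ := Multiset.mem_map.1 hx
      exact hroot z hz
  have habs : ∀ t : ℝ, |Real.log t| = 2 * Real.posLog t - Real.log t := by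
    intro t
    have := Real.half_mul_log_add_log_abs (x := t)
    linarith
  simp only [habs, Multiset.sum_map_sub, Multiset.sum_map_mul_left, hlog]
  linarith

end Polynomial

lemma abs_sub_one_le_mul_abs_log {t R : ℝ} (ht : 0 < t) (htR : t ≤ R) (hR : 1 ≤ R) :
    |t - 1| ≤ R * |Real.log t| := by
  rcases le_total t 1 with h | h
  · rw [abs_of_nonpos (by linarith), abs_of_nonpos (Real.log_nonpos ht.le h)]
    have h1 := Real.log_le_sub_one_of_pos ht
    nlinarith
  · rw [abs_of_nonneg (by linarith), abs_of_nonneg (Real.log_nonneg h)]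
    have h1 := Real.one_sub_inv_le_log_of_pos ht
    have h2 := Real.log_nonneg h
    calc t - 1 = t * (1 - t⁻¹) := by field_simp
      _ ≤ t * Real.log t := by gcongr
      _ ≤ _ := by gcongr

lemma sum_range_le_of_le_geometric {a : ℕ → ℝ} {C r : ℝ} {d : ℕ} (hC : 0 ≤ C) (hr : 1 < r)
    (h : ∀ k ≤ d, a (d - k) ≤ C * r ^ k) :
    ∑ i ∈ Finset.range (d + 1), a i ≤ C * (r / (r - 1)) * r ^ d := by
  have hr1 : 0 < r - 1 := by linarith
  rw [← Finset.sum_range_reflect]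
  calc ∑ j ∈ Finset.range (d + 1), a (d + 1 - 1 - j)
      ≤ ∑ j ∈ Finset.range (d + 1), C * r ^ j :=
        Finset.sum_le_sum fun j hj => h j (by simpa [Nat.lt_succ_iff] using hj)
    _ = C * ((r ^ (d + 1) - 1) / (r - 1)) := by
        rw [← Finset.mul_sum, geom_sum_eq hr.ne']
    _ ≤ C * (r ^ (d + 1) / (r - 1)) := by gcongr; linarith
    _ = _ := by rw [pow_succ]; ring

/-- Roots of monic polynomials of growing degree equidistribute on the unit circle, provided the
constant coefficients stay away from zero and the coefficients, read from the leading one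
downwards, grow uniformly subexponentially. -/
theorem tendsto_mean_roots {P : ℕ → Polynomial ℂ} {c : ℝ} (hc : 0 < c)
    (hmonic : ∀ᶠ n in atTop, (P n).Monic)
    (hdeg : Tendsto (fun n => (P n).natDegree) atTop atTop)
    (hzero : ∀ᶠ n in atTop, c ≤ ‖(P n).coeff 0‖)
    (hcoeff : ∀ r : ℝ, 1 < r → ∃ C : ℝ, 0 ≤ C ∧ ∀ᶠ n in atTop, ∀ k ≤ (P n).natDegree,
      ‖(P n).coeff ((P n).natDegree - k)‖ ≤ C * r ^ k)
    (g : BoundedContinuousFunction ℂ ℝ) :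
    Tendsto (fun n => (P n).roots.mean g) atTop (nhds (∫ z, g z ∂circleUniform)) := by
  have hcard : ∀ n, Multiset.card (P n).roots = (P n).natDegree := fun n =>
    Polynomial.splits_iff_card_roots.1 (IsAlgClosed.splits (P n))
  have hdegR : Tendsto (fun n => ((P n).natDegree : ℝ)) atTop atTop :=
    tendsto_natCast_atTop_atTop.comp hdeg
  have hS : ∀ᶠ n in atTop, (P n).roots ≠ 0 := by
    filter_upwards [hdeg.eventually_gt_atTop 0] with n hn h
    have := hcard n
    rw [h, Multiset.card_zero] at this
    omega
  obtain ⟨C₂, hC₂, hcoeff₂⟩ := hcoeff 2 one_lt_two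
  set R : ℝ := 2 * (1 + C₂) with hRdef
  have hR1 : 1 ≤ R := by linarith
  have hR : ∀ᶠ n in atTop, ∀ z ∈ (P n).roots, ‖z‖ ≤ R := by
    filter_upwards [hmonic, hcoeff₂] with n h1 h2 z hz
    exact Polynomial.norm_root_le h1 zero_le_two hC₂ h2 (Polynomial.isRoot_of_mem_roots hz)
  refine tendsto_mean_circleUniform hS hR ?_ (fun k hk => ?_) g
  · rw [Metric.tendsto_nhds]
    intro ε hε
    set η : ℝ := ε / (4 * R) with hη
    have hη0 : 0 < η := by positivity
    obtain ⟨C, hC, hcoeffC⟩ := hcoeff (Real.exp η) (Real.one_lt_exp_iff.2 hη0)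
    set A : ℝ := C * (Real.exp η / (Real.exp η - 1)) with hA
    have hlim : Tendsto (fun n => R * ((2 * Real.log A - Real.log c) / (P n).natDegree) + ε / 2)
        atTop (nhds (ε / 2)) := by
      simpa using ((hdegR.const_div_atTop (2 * Real.log A - Real.log c)).const_mul R).add_const
        (ε / 2)
    filter_upwards [hS, hR, hmonic, hzero, hcoeffC, hdeg.eventually_gt_atTop 0,
      hlim.eventually_lt_const (half_lt_self hε)] with n hSn hRn hmon hz hcf hd hlt
    have hc0 : (P n).coeff 0 ≠ 0 := by
      intro h
      rw [h, norm_zero] at hz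
      linarith
    set d := (P n).natDegree with hddef
    have hdpos : (0 : ℝ) < d := by exact_mod_cast hd
    have hL := sum_range_le_of_le_geometric (a := fun i => ‖(P n).coeff i‖) hC
      (Real.one_lt_exp_iff.2 hη0) hcf
    have hL0 : 0 < ∑ i ∈ Finset.range (d + 1), ‖(P n).coeff i‖ :=
      Finset.sum_pos' (fun _ _ => norm_nonneg _) ⟨0, by simp, by simpa using hc0⟩
    have hApos : 0 < A := by
      have h1 := hL0.trans_le hL
      exact pos_of_mul_pos_left h1 (by positivity)
    have hlogL : Real.log (∑ i ∈ Finset.range (d + 1), ‖(P n).coeff i‖) ≤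
        Real.log A + d * η := by
      refine (Real.log_le_log hL0 hL).trans_eq ?_
      rw [Real.log_mul hApos.ne' (by positivity), Real.log_pow, Real.log_exp]
    have hsum := Polynomial.sum_abs_log_norm_roots_le hmon hc0
    have hlogc : Real.log c ≤ Real.log ‖(P n).coeff 0‖ := Real.log_le_log hc hz
    have hroots : ∀ z ∈ (P n).roots, |‖z‖ - 1| ≤ R * |Real.log ‖z‖| := by
      intro z hz
      refine abs_sub_one_le_mul_abs_log ?_ (hRn z hz) hR1
      rw [norm_pos_iff]
      rintro rfl
      exact hc0 (by
        simpa [Polynomial.IsRoot, ← Polynomial.coeff_zero_eq_eval_zero] using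
          Polynomial.isRoot_of_mem_roots hz)
    have hnonneg : 0 ≤ (P n).roots.mean fun z => |‖z‖ - 1| := by
      rw [← Multiset.mean_const hSn (0 : ℝ)]
      exact Multiset.mean_mono fun z _ => abs_nonneg _
    rw [dist_zero_right, Real.norm_of_nonneg hnonneg]
    calc (P n).roots.mean (fun z => |‖z‖ - 1|)
        ≤ (P n).roots.mean fun z => R * |Real.log ‖z‖| := Multiset.mean_mono hroots
      _ = R * ((d : ℝ)⁻¹ * ((P n).roots.map fun z => |Real.log ‖z‖|).sum) := by
          rw [Multiset.mean_const_mul, Multiset.mean, hcard, smul_eq_mul]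
      _ ≤ R * ((d : ℝ)⁻¹ * (2 * Real.log A - Real.log c + 2 * (d * η))) := by
          gcongr
          linarith
      _ = R * ((2 * Real.log A - Real.log c) / d) + ε / 2 := by
          rw [hη]
          field_simp
          ring
      _ < ε := hlt
  · obtain ⟨B, hB⟩ := exists_norm_sum_map_pow_le (fun j => C₂ * 2 ^ j) k
    refine squeeze_zero_norm' ?_ (hdegR.const_div_atTop B)
    filter_upwards [hmonic, hcoeff₂] with n h1 h2
    have h := hB (P n).roots (Polynomial.norm_esymm_roots_le h1 zero_le_two hC₂ h2) hk
    rw [Multiset.mean, hcard, norm_smul, norm_inv, Real.norm_natCast, inv_mul_eq_div]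
    gcongr

/-- **Theorem 4.4:** as `n → ∞`, the empirical root measures of the unimodal rank
principal polynomials `Q_n(w)` converge weakly to the uniform probability measure on the
unit circle. -/
theorem unimodalPrincipal_roots_equidistribute :
    ∀ g : BoundedContinuousFunction ℂ ℝ,
      Tendsto (fun n : ℕ => ∫ z, g z ∂(rootMeasure (unimodalPrincipal n))) atTop
        (nhds (∫ z, g z ∂circleUniform)) := by
  intro g
  simp only [integral_rootMeasure_s18]
  refine tendsto_mean_roots (c := 1 / 2) (by norm_num) ?_ ?_ ?_ (fun r hr => ?_) g
  · exact (eventually_ge_atTop 2).mono fun n hn => monic_unimodalPrincipal hn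
  · refine (tendsto_sub_atTop_nat 1).congr' ?_
    exact (eventually_ge_atTop 2).mono fun n hn => (natDegree_unimodalPrincipal hn).symm
  · exact (eventually_ge_atTop 1).mono fun n hn => half_le_norm_coeff_zero_unimodalPrincipal hn
  · obtain ⟨C, hC0, hC⟩ := exists_norm_coeff_unimodalPrincipal_le hr
    refine ⟨C, hC0, (eventually_ge_atTop 2).mono fun n hn k hk => ?_⟩
    rw [natDegree_unimodalPrincipal hn] at hk ⊢
    exact hC n hn k hk
end
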